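/- Let p be a prime and G a finite group such that: A_p(G) is connected, G = Ω1(G), O_p(G) = 1, O_{p'}(G) = 1, and G is not isomorphic to a direct product of two nontrivial groups. Suppose G has a normal subgroup N = L1 × ... × Lr which is a direct product of r > 2 nonabelian simple subnormal subgroups of G and satisfies C_G(N) = 1. Then π1(A_p(G)) is a free group; moreover, if A_p(G) is not simply connected, then p is odd, r = p, each A_p(L_i) is disconnected, and the set {L1, ..., Lp} is permuted regularly under conjugation by some subgroup of G of order p. -/

import Mathlib

open Function

/-- The geometric realization of the order complex of the subposet `S` of `X`,
realized as a subspace of `X → ℝ`: convex combinations supported on finite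
nonempty chains contained in `S`. -/
def geomRealOn {X : Type*} [Preorder X] (S : Set X) : Set (X → ℝ) :=
  {f | (∀ x, 0 ≤ f x) ∧ Function.support f ⊆ S ∧ IsChain (· ≤ ·) (Function.support f) ∧
    ∃ s : Finset X, Function.support f ⊆ ↑s ∧ ∑ x ∈ s, f x = 1}

/-- A group is elementary abelian for the prime `p` if it is abelian and
every element has order dividing `p`. -/
def IsElementaryAbelian (p : ℕ) (G : Type*) [Group G] : Prop :=
  (∀ a b : G, a * b = b * a) ∧ ∀ a : G, a ^ p = 1

/-- The Quillen poset `A_p(G)`: nontrivial elementary abelian `p`-subgroups of `G`. -/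
def apSet (p : ℕ) (G : Type*) [Group G] : Set (Subgroup G) :=
  {H | H ≠ ⊥ ∧ IsElementaryAbelian p ↥H}

/-- The poset `A_p(K)` for a subgroup `K ≤ G`, realized inside the subgroup lattice
of `G`. -/
def apSetIn (p : ℕ) {G : Type*} [Group G] (K : Subgroup G) : Set (Subgroup G) :=
  {H | H ≠ ⊥ ∧ IsElementaryAbelian p ↥H ∧ H ≤ K}

/-- `Ω₁(G)`: the subgroup generated by the elements of order `p`. -/
def omega1 (p : ℕ) (G : Type*) [Group G] : Subgroup G :=
  Subgroup.closure {x : G | orderOf x = p}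

/-- The conjugate subgroup `g L g⁻¹`. -/
def conjSub {H : Type*} [Group H] (g : H) (L : Subgroup H) : Subgroup H :=
  L.map ((MulAut.conj g).toMonoidHom)

/-- `L` is a subnormal subgroup. -/
def IsSubnormal {H : Type*} [Group H] (L : Subgroup H) : Prop :=
  ∃ (n : ℕ) (c : ℕ → Subgroup H), c 0 = L ∧ c n = ⊤ ∧
    ∀ i < n, c i ≤ c (i + 1) ∧ ∀ g ∈ c (i + 1), ∀ x ∈ c i, g * x * g⁻¹ ∈ c i

section Realization

open CategoryTheory

variable {X : Type} [PartialOrder X] {S : Set X}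

/-- Points of the realization of the order complex of a finite poset are the functions whose
values are barycentric coordinates on some chain. -/
theorem mem_geomRealOn_iff [Fintype X] {f : X → ℝ} :
    f ∈ geomRealOn S ↔ (∀ x, 0 ≤ f x) ∧ support f ⊆ S ∧ IsChain (· ≤ ·) (support f) ∧
      ∑ x, f x = 1 := by
  constructor
  · rintro ⟨h0, hS, hc, s, hs, hsum⟩
    refine ⟨h0, hS, hc, ?_⟩
    rw [← hsum]
    symm
    refine Finset.sum_subset (Finset.subset_univ s) fun x _ hx => ?_
    by_contra h
    exact hx (hs h)
  · rintro ⟨h0, hS, hc, hsum⟩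
    exact ⟨h0, hS, hc, Finset.univ, by simp, hsum⟩

theorem support_nonempty_of_mem_geomRealOn {f : X → ℝ} (hf : f ∈ geomRealOn S) :
    (support f).Nonempty := by
  obtain ⟨-, -, -, s, -, hsum⟩ := hf
  by_contra h
  rw [Set.not_nonempty_iff_eq_empty, support_eq_empty_iff] at h
  simp [h] at hsum

theorem isChain_pair {v w : S} (h : v ≤ w ∨ w ≤ v) : IsChain (· ≤ ·) ({v, w} : Set S) := by
  rw [Set.pair_comm]
  refine IsChain.insert (Set.subsingleton_singleton.isChain) ?_
  rintro b rfl -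
  exact h.symm

/-- The union of the closed simplices whose vertices are comparable to all elements of `C`. -/
def chainStar (C : Set S) : Set (X → ℝ) :=
  {f | f ∈ geomRealOn S ∧ ∀ v ∈ C, ∀ x, f x ≠ 0 → v.1 ≤ x ∨ x ≤ v.1}

theorem chainStar_anti {C D : Set S} (h : C ⊆ D) : chainStar D ⊆ chainStar C :=
  fun _ hf => ⟨hf.1, fun v hv => hf.2 v (h hv)⟩

theorem mem_chainStar_singleton {f : geomRealOn S} {v : S} (h : f.1 v.1 ≠ 0) :
    f.1 ∈ chainStar {v} := by
  refine ⟨f.2, fun w hw x hx => ?_⟩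
  rw [Set.mem_singleton_iff.1 hw]
  exact f.2.2.2.1.total h hx

variable [Finite X]

open Classical in
/-- The vertex of the realization given by an element of the poset. -/
noncomputable def geomVertex (v : S) : geomRealOn S :=
  ⟨Pi.single v.1 1, by
    have := Fintype.ofFinite X
    refine mem_geomRealOn_iff.2 ⟨fun x => ?_, ?_, ?_, by simp⟩
    · by_cases h : x = v.1
      · subst h; simp
      · simp [h]
    · refine (Pi.support_single_subset).trans ?_
      simp
    · exact (Set.subsingleton_singleton.anti Pi.support_single_subset).isChain⟩

theorem geomVertex_apply_pos (v : S) : 0 < (geomVertex v).1 v.1 := by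
  simp [geomVertex]

theorem eq_of_geomVertex_apply_ne_zero {v : S} {x : X} (h : (geomVertex v).1 x ≠ 0) : x = v := by
  by_contra hx
  simp [geomVertex, hx] at h

theorem starConvex_chainStar {C : Set S} (hC : IsChain (· ≤ ·) C) {v : S} (hv : v ∈ C) :
    StarConvex ℝ (geomVertex v).1 (chainStar C) := by
  classical
  have := Fintype.ofFinite X
  intro y hy a b ha hb hab
  have hsupp : ∀ x, (a • (geomVertex v).1 + b • y) x ≠ 0 → x = v.1 ∨ y x ≠ 0 := by
    intro x hx
    by_contra! h
    apply hx
    have h1 : (geomVertex v).1 x = 0 := by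
      by_contra h'
      exact h.1 (eq_of_geomVertex_apply_ne_zero h')
    simp [h1, h.2]
  have hy' := mem_geomRealOn_iff.1 hy.1
  have hv' := mem_geomRealOn_iff.1 (geomVertex v).2
  refine ⟨mem_geomRealOn_iff.2 ⟨fun x => ?_, fun x hx => ?_, ?_, ?_⟩, ?_⟩
  · have := hy'.1 x
    have := hv'.1 x
    simp only [Pi.add_apply, Pi.smul_apply, smul_eq_mul]
    positivity
  · rcases hsupp x hx with rfl | h
    · exact v.2
    · exact hy'.2.1 h
  · refine IsChain.mono (t := insert v.1 (support y)) ?_ ?_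
    · intro x hx
      exact hsupp x hx
    · exact hy'.2.2.1.insert fun b hb _ => hy.2 v hv b hb
  · simp [Finset.sum_add_distrib, ← Finset.mul_sum, hy'.2.2.2, hv'.2.2.2, hab]
  · intro w hw x hx
    rcases hsupp x hx with rfl | h
    · rcases hC.total hw hv with h | h
      · exact .inl h
      · exact .inr h
    · exact hy.2 w hw x h

theorem geomVertex_mem_chainStar {C : Set S} (hC : IsChain (· ≤ ·) C) {v : S} (hv : v ∈ C) :
    (geomVertex v).1 ∈ chainStar C := by
  refine ⟨(geomVertex v).2, fun w hw x hx => ?_⟩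
  rw [eq_of_geomVertex_apply_ne_zero hx]
  rcases hC.total hw hv with h | h
  · exact .inl h
  · exact .inr h

theorem simplyConnectedSpace_chainStar {C : Set S} (hC : IsChain (· ≤ ·) C) (hne : C.Nonempty) :
    SimplyConnectedSpace (chainStar C) := by
  obtain ⟨v, hv⟩ := hne
  have := (starConvex_chainStar hC hv).contractibleSpace ⟨_, geomVertex_mem_chainStar hC hv⟩
  infer_instance

/-- The morphism of the fundamental groupoid represented by the paths inside `chainStar C`. -/
noncomputable def starHom {C : Set S} (hC : IsChain (· ≤ ·) C) (hne : C.Nonempty)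
    {f g : geomRealOn S} (hf : f.1 ∈ chainStar C) (hg : g.1 ∈ chainStar C) :
    FundamentalGroupoid.mk f ⟶ FundamentalGroupoid.mk g :=
  haveI := simplyConnectedSpace_chainStar hC hne
  Path.Homotopic.Quotient.mk
    ((PathConnectedSpace.somePath (⟨f.1, hf⟩ : chainStar C) ⟨g.1, hg⟩).map
      (f := fun z => (⟨z.1, z.2.1⟩ : geomRealOn S)) (by fun_prop))

theorem mk_eq_starHom {C : Set S} (hC : IsChain (· ≤ ·) C) (hne : C.Nonempty)
    {f g : geomRealOn S} (hf : f.1 ∈ chainStar C) (hg : g.1 ∈ chainStar C)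
    (γ : Path f g) (hγ : ∀ t, (γ t).1 ∈ chainStar C) :
    (Path.Homotopic.Quotient.mk γ : FundamentalGroupoid.mk f ⟶ FundamentalGroupoid.mk g) =
      starHom hC hne hf hg := by
  have := simplyConnectedSpace_chainStar hC hne
  let γ' : Path (⟨f.1, hf⟩ : chainStar C) ⟨g.1, hg⟩ :=
    { toFun := fun t => ⟨(γ t).1, hγ t⟩
      continuous_toFun := by fun_prop
      source' := by simp
      target' := by simp }
  have h := SimplyConnectedSpace.paths_homotopic γ'
    (PathConnectedSpace.somePath (⟨f.1, hf⟩ : chainStar C) ⟨g.1, hg⟩)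
  exact Path.Homotopic.Quotient.eq.2
    (h.map (⟨fun z => (⟨z.1, z.2.1⟩ : geomRealOn S), by fun_prop⟩ : C(chainStar C, geomRealOn S)))

theorem exists_mk_eq_starHom {C : Set S} (hC : IsChain (· ≤ ·) C) (hne : C.Nonempty)
    {f g : geomRealOn S} (hf : f.1 ∈ chainStar C) (hg : g.1 ∈ chainStar C) :
    ∃ γ : Path f g, (∀ t, (γ t).1 ∈ chainStar C) ∧
      (Path.Homotopic.Quotient.mk γ : FundamentalGroupoid.mk f ⟶ FundamentalGroupoid.mk g) =
        starHom hC hne hf hg := by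
  have := simplyConnectedSpace_chainStar hC hne
  exact ⟨(PathConnectedSpace.somePath (⟨f.1, hf⟩ : chainStar C) ⟨g.1, hg⟩).map
      (f := fun z => (⟨z.1, z.2.1⟩ : geomRealOn S)) (by fun_prop),
    fun t => (PathConnectedSpace.somePath (⟨f.1, hf⟩ : chainStar C) ⟨g.1, hg⟩ t).2, rfl⟩

theorem starHom_comp {C : Set S} (hC : IsChain (· ≤ ·) C) (hne : C.Nonempty)
    {f g h : geomRealOn S} (hf : f.1 ∈ chainStar C) (hg : g.1 ∈ chainStar C)
    (hh : h.1 ∈ chainStar C) :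
    starHom hC hne hf hg ≫ starHom hC hne hg hh = starHom hC hne hf hh := by
  obtain ⟨γ, hγ, h1⟩ := exists_mk_eq_starHom hC hne hf hg
  obtain ⟨γ', hγ', h2⟩ := exists_mk_eq_starHom hC hne hg hh
  rw [← h1, ← h2, ← mk_eq_starHom hC hne hf hh (γ.trans γ')]
  · rfl
  · intro t
    rw [Path.trans_apply]
    split_ifs
    · exact hγ _
    · exact hγ' _

theorem starHom_self {C : Set S} (hC : IsChain (· ≤ ·) C) (hne : C.Nonempty)
    {f : geomRealOn S} (hf : f.1 ∈ chainStar C) :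
    starHom hC hne hf hf = 𝟙 _ := by
  rw [← mk_eq_starHom hC hne hf hf (Path.refl f) fun _ => hf]
  rfl

theorem starHom_mono {C D : Set S} (h : C ⊆ D) (hC : IsChain (· ≤ ·) C) (hCne : C.Nonempty)
    (hD : IsChain (· ≤ ·) D) {f g : geomRealOn S} (hf : f.1 ∈ chainStar D)
    (hg : g.1 ∈ chainStar D) :
    starHom hC hCne (chainStar_anti h hf) (chainStar_anti h hg) =
      starHom hD (hCne.mono h) hf hg := by
  obtain ⟨γ, hγ, h1⟩ := exists_mk_eq_starHom hD (hCne.mono h) hf hg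
  rw [← h1, mk_eq_starHom hC hCne _ _ γ fun t => chainStar_anti h (hγ t)]

/-- The edge of the realization joining two comparable vertices. -/
noncomputable def edgeHom {v w : S} (h : v ≤ w ∨ w ≤ v) :
    FundamentalGroupoid.mk (geomVertex v) ⟶ FundamentalGroupoid.mk (geomVertex w) :=
  starHom (C := {v, w}) (isChain_pair h) (by simp)
    (geomVertex_mem_chainStar (isChain_pair h) (by simp))
    (geomVertex_mem_chainStar (isChain_pair h) (by simp))

/-- The morphism from a vertex to a point of its open star. -/
noncomputable def spokeHom {v : S} {f : geomRealOn S} (h : f.1 v.1 ≠ 0) :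
    FundamentalGroupoid.mk (geomVertex v) ⟶ FundamentalGroupoid.mk f :=
  starHom (C := {v}) (Set.subsingleton_singleton.isChain) (by simp)
    (geomVertex_mem_chainStar (Set.subsingleton_singleton.isChain) rfl)
    (mem_chainStar_singleton h)

theorem edgeHom_eq_starHom {v w : S} (h : v ≤ w ∨ w ≤ v) {C : Set S}
    (hC : IsChain (· ≤ ·) C) (hv : v ∈ C) (hw : w ∈ C) :
    edgeHom h = starHom hC (Set.nonempty_of_mem hv) (geomVertex_mem_chainStar hC hv)
      (geomVertex_mem_chainStar hC hw) :=
  starHom_mono (by rintro x (rfl | rfl) <;> assumption) _ _ _ _ _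

theorem edgeHom_comp {u v w : S} (huv : u ≤ v) (hvw : v ≤ w) :
    edgeHom (.inl huv) ≫ edgeHom (.inl hvw) = edgeHom (.inl (huv.trans hvw)) := by
  have hC : IsChain (· ≤ ·) ({u, v, w} : Set S) := by
    refine IsChain.insert (isChain_pair (.inl hvw)) ?_
    rintro b (rfl | rfl) -
    · exact .inl huv
    · exact .inl (huv.trans hvw)
  rw [edgeHom_eq_starHom (.inl huv) hC (by simp) (by simp),
    edgeHom_eq_starHom (.inl hvw) hC (by simp) (by simp),
    edgeHom_eq_starHom (.inl (huv.trans hvw)) hC (by simp) (by simp), starHom_comp]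

theorem edgeHom_symm {v w : S} (h : v ≤ w ∨ w ≤ v) :
    edgeHom h.symm = Groupoid.inv (edgeHom h) := by
  rw [← cancel_epi (edgeHom h), Groupoid.comp_inv,
    edgeHom_eq_starHom h.symm (isChain_pair h) (by simp) (by simp), edgeHom, starHom_comp,
    starHom_self]

theorem edgeHom_comp_spokeHom {v w : S} {f : geomRealOn S} (hv : f.1 v.1 ≠ 0) (hw : f.1 w.1 ≠ 0) :
    edgeHom (f.2.2.2.1.total hv hw) ≫ spokeHom hw = spokeHom hv := by
  have hC := isChain_pair (v := v) (w := w) (f.2.2.2.1.total hv hw)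
  have hf : f.1 ∈ chainStar {v, w} := by
    refine ⟨f.2, ?_⟩
    rintro u (rfl | rfl) x hx
    · exact f.2.2.2.1.total hv hx
    · exact f.2.2.2.1.total hw hx
  have h1 : spokeHom hw = starHom hC (by simp) (geomVertex_mem_chainStar hC (by simp)) hf :=
    starHom_mono (by simp) _ _ _ _ _
  have h2 : spokeHom hv = starHom hC (by simp) (geomVertex_mem_chainStar hC (by simp)) hf :=
    starHom_mono (by simp) _ _ _ _ _
  rw [h1, h2, edgeHom, starHom_comp]

theorem spokeHom_comp_mk {v : S} {f g : geomRealOn S} (hf : f.1 v.1 ≠ 0) (hg : g.1 v.1 ≠ 0)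
    (γ : Path f g) (hγ : ∀ t, (γ t).1 v.1 ≠ 0) :
    spokeHom hf ≫ (Path.Homotopic.Quotient.mk γ :
      FundamentalGroupoid.mk f ⟶ FundamentalGroupoid.mk g) = spokeHom hg := by
  rw [mk_eq_starHom (C := {v}) Set.subsingleton_singleton.isChain (by simp)
    (mem_chainStar_singleton hf) (mem_chainStar_singleton hg) γ
    fun t => mem_chainStar_singleton (hγ t), spokeHom, starHom_comp]
  rfl

end Realization

section PosetCohomology

variable {X : Type} [PartialOrder X]

/-- Combinatorial connectedness of a subposet: it is nonempty and every property invariant under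
comparability is constant on it. -/
def PosetConn (S : Set X) : Prop :=
  S.Nonempty ∧ ∀ P : X → Prop, (∀ x ∈ S, ∀ y ∈ S, x ≤ y → (P x ↔ P y)) →
    ∀ x ∈ S, ∀ y ∈ S, P x → P y

/-- A `1`-cocycle on a subposet with values in a possibly nonabelian group. -/
def IsPosetCocycle {H : Type} [Group H] (S : Set X) (c : X → X → H) : Prop :=
  ∀ x ∈ S, ∀ y ∈ S, ∀ z ∈ S, x ≤ y → y ≤ z → c x y * c y z = c x z

/-- Every group-valued `1`-cocycle on the subposet is a coboundary. -/
def PosetH1Trivial (S : Set X) : Prop :=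
  ∀ (H : Type) [Group H] (c : X → X → H), IsPosetCocycle S c →
    ∃ d : X → H, ∀ x ∈ S, ∀ y ∈ S, x ≤ y → c x y = (d x)⁻¹ * d y

theorem IsPosetCocycle.self {H : Type} [Group H] {S : Set X} {c : X → X → H}
    (hc : IsPosetCocycle S c) {x : X} (hx : x ∈ S) : c x x = 1 := by
  simpa using hc x hx x hx x hx le_rfl le_rfl

end PosetCohomology

section Edges

open CategoryTheory unitInterval

variable {X : Type} [PartialOrder X] {S : Set X}

/-- A connected realization has a combinatorially connected poset. -/
theorem PosetConn.of_connectedSpace (h : ConnectedSpace (geomRealOn S)) : PosetConn S := by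
  have hopen : ∀ P : X → Prop, IsOpen {f : geomRealOn S | ∃ v, f.1 v ≠ 0 ∧ P v} := by
    intro P
    have : {f : geomRealOn S | ∃ v, f.1 v ≠ 0 ∧ P v} =
        ⋃ v : {v // P v}, {f : geomRealOn S | f.1 v.1 ≠ 0} := by
      ext f
      simp [and_comm]
    rw [this]
    refine isOpen_iUnion fun v => isOpen_ne_fun
      ((continuous_apply v.1).comp continuous_subtype_val) continuous_const
  constructor
  · obtain ⟨f⟩ := h.toNonempty
    obtain ⟨v, hv⟩ := support_nonempty_of_mem_geomRealOn f.2
    exact ⟨v, f.2.2.1 hv⟩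
  · intro P hP x hx y hy hPx
    by_contra hPy
    let U : Set (geomRealOn S) := {f | ∃ v, f.1 v ≠ 0 ∧ P v}
    have hcompl : Uᶜ = {f : geomRealOn S | ∃ v, f.1 v ≠ 0 ∧ ¬ P v} := by
      ext f
      constructor
      · intro hf
        obtain ⟨v, hv⟩ := support_nonempty_of_mem_geomRealOn f.2
        exact ⟨v, hv, fun hPv => hf ⟨v, hv, hPv⟩⟩
      · rintro ⟨v, hv, hPv⟩ ⟨w, hw, hPw⟩
        rcases f.2.2.2.1.total hv hw with h | h
        · exact hPv ((hP v (f.2.2.1 hv) w (f.2.2.1 hw) h).2 hPw)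
        · exact hPv ((hP w (f.2.2.1 hw) v (f.2.2.1 hv) h).1 hPw)
    have hclopen : IsClopen U := ⟨⟨hcompl ▸ hopen fun v => ¬ P v⟩, hopen P⟩
    classical
    have hvert : ∀ z ∈ S, (Pi.single z 1 : X → ℝ) ∈ geomRealOn S := by
      intro z hz
      refine ⟨fun w => ?_, (Pi.support_single_subset).trans (by simpa using hz),
        (Set.subsingleton_singleton.anti Pi.support_single_subset).isChain, {z},
        by simp, by simp⟩
      by_cases h : w = z
      · subst h; simp
      · simp [h]
    rcases isClopen_iff.1 hclopen with h0 | h1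
    · have : (⟨_, hvert x hx⟩ : geomRealOn S) ∈ U := ⟨x, by simp, hPx⟩
      simp [h0] at this
    · have : (⟨_, hvert y hy⟩ : geomRealOn S) ∈ U := by simp [h1]
      obtain ⟨v, hv, hPv⟩ := this
      by_cases h : v = y
      · exact hPy (h ▸ hPv)
      · simp [h] at hv

variable [Finite X]

theorem PosetConn.pathConnectedSpace (h : PosetConn S) : PathConnectedSpace (geomRealOn S) := by
  obtain ⟨⟨x, hx⟩, hP⟩ := h
  have hedge : ∀ y (hy : y ∈ S), Joined (geomVertex ⟨x, hx⟩) (geomVertex ⟨y, hy⟩) := by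
    intro y hy
    have := hP (fun y => ∃ hy : y ∈ S, Joined (geomVertex ⟨x, hx⟩) (geomVertex ⟨y, hy⟩)) ?_
      x hx y hy
      ⟨hx, Joined.refl _⟩
    · exact this.2
    · intro u hu v hv huv
      have hC := isChain_pair (v := (⟨u, hu⟩ : S)) (w := ⟨v, hv⟩) (.inl huv)
      obtain ⟨γ, -⟩ := exists_mk_eq_starHom hC (by simp)
        (geomVertex_mem_chainStar hC (v := ⟨u, hu⟩) (by simp))
        (geomVertex_mem_chainStar hC (v := ⟨v, hv⟩) (by simp))
      exact ⟨fun h => ⟨hv, h.2.trans ⟨γ⟩⟩, fun h => ⟨hu, h.2.trans ⟨γ.symm⟩⟩⟩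
  have hall : ∀ f : geomRealOn S, Joined (geomVertex ⟨x, hx⟩) f := by
    intro f
    obtain ⟨v, hv⟩ := support_nonempty_of_mem_geomRealOn f.2
    have hv' : f.1 (⟨v, f.2.2.1 hv⟩ : S).1 ≠ 0 := hv
    obtain ⟨γ, -⟩ := exists_mk_eq_starHom (Set.subsingleton_singleton.isChain) (by simp)
        (geomVertex_mem_chainStar (Set.subsingleton_singleton.isChain) rfl)
        (mem_chainStar_singleton hv')
    exact (hedge v (f.2.2.1 hv)).trans ⟨γ⟩
  exact ⟨⟨geomVertex ⟨x, hx⟩⟩, fun f g => (hall f).symm.trans (hall g)⟩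

theorem mk_subpath_trans {Y : Type*} [TopologicalSpace Y] {a b : Y} (γ : Path a b) (s t u : I) :
    (FundamentalGroupoid.fromPath (Path.Homotopic.Quotient.mk (γ.subpath s t))) ≫
      FundamentalGroupoid.fromPath (Path.Homotopic.Quotient.mk (γ.subpath t u)) =
    FundamentalGroupoid.fromPath (Path.Homotopic.Quotient.mk (γ.subpath s u)) :=
  Path.Homotopic.Quotient.eq.2 ⟨Path.Homotopy.subpathTransSubpath γ s t u⟩

/-- The fundamental group of the realization is generated by the loops running along one edge. -/
theorem eq_top_of_forall_edge_mem {x₀ : geomRealOn S}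
    (q : ∀ v : S, FundamentalGroupoid.mk x₀ ⟶ FundamentalGroupoid.mk (geomVertex v))
    (R : Subgroup (FundamentalGroup (geomRealOn S) x₀))
    (hR : ∀ (v w : S) (h : v ≤ w), q w ≫ edgeHom (.inr h) ≫ inv (q v) ∈ R) : R = ⊤ := by
  have hinv : ∀ a b : FundamentalGroupoid.mk x₀ ⟶ FundamentalGroupoid.mk x₀, a ≫ b = 𝟙 _ →
      a ∈ R → b ∈ R := by
    intro a b hab ha
    have : (b : FundamentalGroup (geomRealOn S) x₀) = (a : FundamentalGroup (geomRealOn S) x₀)⁻¹ :=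
      @eq_inv_of_mul_eq_one_left (FundamentalGroup (geomRealOn S) x₀) _ b a hab
    exact this ▸ R.inv_mem ha
  have hR' : ∀ (v w : S) (h : v ≤ w ∨ w ≤ v), q v ≫ edgeHom h ≫ inv (q w) ∈ R := by
    intro v w h
    rcases h with h | h
    · have h2 : edgeHom (.inr h) = Groupoid.inv (edgeHom (.inl h)) := edgeHom_symm (.inl h)
      have h1 : (q w ≫ edgeHom (.inr h) ≫ inv (q v)) ≫ (q v ≫ edgeHom (.inl h) ≫ inv (q w)) =
          𝟙 _ := by
        rw [h2]
        simp
      exact hinv _ _ h1 (hR v w h)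
    · exact hR w v h
  have hsupp : ∀ f : geomRealOn S, ∃ v : S, f.1 v.1 ≠ 0 := by
    intro f
    obtain ⟨v, hv⟩ := support_nonempty_of_mem_geomRealOn f.2
    exact ⟨⟨v, f.2.2.1 hv⟩, hv⟩
  choose b hb using hsupp
  let T : ∀ f : geomRealOn S, FundamentalGroupoid.mk x₀ ⟶ FundamentalGroupoid.mk f :=
    fun f => q (b f) ≫ spokeHom (hb f)
  have hlocal : ∀ (f g : geomRealOn S) (γ : Path f g) (v : S) (hγ : ∀ t, (γ t).1 v.1 ≠ 0),
      T f ≫ (Path.Homotopic.Quotient.mk γ :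
        FundamentalGroupoid.mk f ⟶ FundamentalGroupoid.mk g) ≫ inv (T g) ∈ R := by
    intro f g γ v hγ
    have hf : f.1 v.1 ≠ 0 := by simpa using hγ 0
    have hg : g.1 v.1 ≠ 0 := by simpa using hγ 1
    have h1 := hR' (b f) v (f.2.2.2.1.total (hb f) hf)
    have h2 := hR' v (b g) (g.2.2.2.1.total hg (hb g))
    have e1 := edgeHom_comp_spokeHom (hb f) hf
    have e2 := edgeHom_comp_spokeHom hg (hb g)
    have e3 := spokeHom_comp_mk hf hg γ hγ
    have e4 : T f ≫ (Path.Homotopic.Quotient.mk γ :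
        FundamentalGroupoid.mk f ⟶ FundamentalGroupoid.mk g) ≫ inv (T g) =
        (q (b f) ≫ edgeHom (f.2.2.2.1.total (hb f) hf) ≫ inv (q v)) ≫
          (q v ≫ edgeHom (g.2.2.2.1.total hg (hb g)) ≫ inv (q (b g))) := by
      simp only [T, ← e1]
      rw [← cancel_mono (q (b g) ≫ spokeHom (hb g))]
      simp only [Category.assoc, IsIso.inv_hom_id, IsIso.inv_hom_id_assoc, Category.comp_id, e2, e3]
    rw [e4]
    exact R.mul_mem h2 h1
  have hclaim : ∀ (γ : Path x₀ x₀), T x₀ ≫ (Path.Homotopic.Quotient.mk γ :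
        FundamentalGroupoid.mk x₀ ⟶ FundamentalGroupoid.mk x₀) ≫ inv (T x₀) ∈ R := by
    intro γ
    let A : I → FundamentalGroup (geomRealOn S) x₀ := fun t =>
      T (γ 0) ≫ (Path.Homotopic.Quotient.mk (γ.subpath 0 t) :
        FundamentalGroupoid.mk (γ 0) ⟶ FundamentalGroupoid.mk (γ t)) ≫ inv (T (γ t))
    have hA : IsLocallyConstant fun t => A t ∈ R := by
      rw [IsLocallyConstant.iff_exists_open]
      intro t
      obtain ⟨v, hv⟩ : ∃ v : S, (γ t).1 v.1 ≠ 0 := ⟨b (γ t), hb _⟩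
      have hopen : IsOpen {s : I | (γ s).1 v.1 ≠ 0} := isOpen_ne_fun
        ((continuous_apply v.1).comp (continuous_subtype_val.comp γ.continuous)) continuous_const
      obtain ⟨ε, hε, hball⟩ := Metric.isOpen_iff.1 hopen t hv
      refine ⟨Metric.ball t ε, Metric.isOpen_ball, Metric.mem_ball_self hε, fun s hs => ?_⟩
      have hseg : ∀ u, ((γ.subpath t s) u).1 v.1 ≠ 0 := by
        intro u
        have hu : (γ.subpath t s) u ∈ γ '' Set.uIcc t s := by
          rw [← Path.range_subpath]
          exact ⟨u, rfl⟩
        obtain ⟨w, hw, hwu⟩ := hu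
        rw [← hwu]
        apply hball
        rw [Metric.mem_ball] at hs ⊢
        refine lt_of_le_of_lt ?_ hs
        have := Set.abs_sub_left_of_mem_uIcc (a := (t : ℝ)) (b := s) (c := w) ?_
        · rwa [Subtype.dist_eq, Subtype.dist_eq, Real.dist_eq, Real.dist_eq]
        · rcases Set.mem_uIcc.1 hw with h | h
          · exact Set.mem_uIcc.2 (.inl h)
          · exact Set.mem_uIcc.2 (.inr h)
      have hmem := hlocal _ _ (γ.subpath t s) v hseg
      have hAst : A s = (A t ≫ (T (γ t) ≫ (Path.Homotopic.Quotient.mk (γ.subpath t s) :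
        FundamentalGroupoid.mk (γ t) ⟶ FundamentalGroupoid.mk (γ s)) ≫ inv (T (γ s))) :
          FundamentalGroupoid.mk x₀ ⟶ FundamentalGroupoid.mk x₀) := by
        have := mk_subpath_trans γ 0 t s
        simp only [A]
        rw [← cancel_mono (T (γ s))]
        simp only [Category.assoc, IsIso.inv_hom_id, IsIso.inv_hom_id_assoc, Category.comp_id]
        congr 1
        exact this.symm
      rw [hAst]
      exact propext (R.mul_mem_cancel_left hmem)
    have hA0 : A 0 ∈ R := by
      have : A 0 = 1 := by
        change T (γ 0) ≫ (Path.Homotopic.Quotient.mk (γ.subpath 0 0) :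
          FundamentalGroupoid.mk (γ 0) ⟶ FundamentalGroupoid.mk (γ 0)) ≫ inv (T (γ 0)) = 𝟙 _
        rw [Path.subpath_self]
        rw [← cancel_mono (T (γ 0))]
        simp only [Category.assoc, IsIso.inv_hom_id, Category.comp_id, Category.id_comp]
        exact Category.comp_id (T (γ 0))
      rw [this]
      exact R.one_mem
    have hA1 : A 1 ∈ R := by
      have := hA.apply_eq_of_preconnectedSpace 0 1
      exact this ▸ hA0
    have h2 : A 1 = T (γ 0) ≫ (Path.Homotopic.Quotient.mk (γ.cast γ.source γ.target) :
        FundamentalGroupoid.mk (γ 0) ⟶ FundamentalGroupoid.mk (γ 1)) ≫ inv (T (γ 1)) := by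
      simp only [A, Path.subpath_zero_one]
    have h3 : ∀ (f g : geomRealOn S) (hf : f = x₀) (hg : g = x₀),
        T x₀ ≫ (Path.Homotopic.Quotient.mk γ :
        FundamentalGroupoid.mk x₀ ⟶ FundamentalGroupoid.mk x₀) ≫ inv (T x₀) =
        T f ≫ (Path.Homotopic.Quotient.mk (γ.cast hf hg) :
        FundamentalGroupoid.mk f ⟶ FundamentalGroupoid.mk g) ≫ inv (T g) := by
      rintro _ _ rfl h
      subst h
      rfl
    rw [h3 _ _ γ.source γ.target, ← h2]
    exact hA1
  rw [eq_top_iff]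
  intro g _
  let t : FundamentalGroupoid.mk x₀ ⟶ FundamentalGroupoid.mk x₀ := T x₀
  obtain ⟨γ, hγ⟩ := Path.Homotopic.Quotient.mk_surjective (inv t ≫ g ≫ t)
  have := hclaim γ
  have h4 : T x₀ ≫ (Path.Homotopic.Quotient.mk γ :
        FundamentalGroupoid.mk x₀ ⟶ FundamentalGroupoid.mk x₀) ≫ inv (T x₀) = g := by
    rw [hγ]
    simp [t]
  exact h4 ▸ this

end Edges

section Gauge

open CategoryTheory unitInterval

variable {X : Type} [PartialOrder X] [Finite X] {S : Set X}

/-- If every cocycle on `Z` is a coboundary, then the vertices can be joined to the base point in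
such a way that all edges of `Z` are carried to the trivial loop. -/
theorem exists_gauge [PathConnectedSpace (geomRealOn S)] (x₀ : geomRealOn S) {Z : Set X}
    (hZS : Z ⊆ S) (hZ : PosetH1Trivial Z) :
    ∃ q : ∀ v : S, FundamentalGroupoid.mk x₀ ⟶ FundamentalGroupoid.mk (geomVertex v),
      ∀ v w : S, v.1 ∈ Z → w.1 ∈ Z → ∀ h : v ≤ w, q v ≫ edgeHom (.inl h) = q w := by
  classical
  let q : ∀ v : S, FundamentalGroupoid.mk x₀ ⟶ FundamentalGroupoid.mk (geomVertex v) := fun v =>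
    Path.Homotopic.Quotient.mk (PathConnectedSpace.somePath x₀ (geomVertex v))
  let E : FundamentalGroupoid (geomRealOn S) := FundamentalGroupoid.mk x₀
  let c : X → X → FundamentalGroup (geomRealOn S) x₀ := fun x y =>
    if h : x ∈ S ∧ y ∈ S ∧ x ≤ y then
      ((q ⟨y, h.2.1⟩ ≫ edgeHom (v := (⟨y, h.2.1⟩ : S)) (w := ⟨x, h.1⟩) (.inr h.2.2) ≫
        inv (q ⟨x, h.1⟩) : E ⟶ E))
    else 1
  have hc : IsPosetCocycle Z c := by
    intro x hx y hy z hz hxy hyz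
    have hx' := hZS hx
    have hy' := hZS hy
    have hz' := hZS hz
    simp only [c, dif_pos (show x ∈ S ∧ y ∈ S ∧ x ≤ y from ⟨hx', hy', hxy⟩),
      dif_pos (show y ∈ S ∧ z ∈ S ∧ y ≤ z from ⟨hy', hz', hyz⟩),
      dif_pos (show x ∈ S ∧ z ∈ S ∧ x ≤ z from ⟨hx', hz', hxy.trans hyz⟩)]
    have h1 := edgeHom_comp (u := (⟨x, hx'⟩ : S)) (v := ⟨y, hy'⟩) (w := ⟨z, hz'⟩) hxy hyz
    have h2 := edgeHom_symm (v := (⟨x, hx'⟩ : S)) (w := ⟨y, hy'⟩) (.inl hxy)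
    have h3 := edgeHom_symm (v := (⟨y, hy'⟩ : S)) (w := ⟨z, hz'⟩) (.inl hyz)
    have h4 := edgeHom_symm (v := (⟨x, hx'⟩ : S)) (w := ⟨z, hz'⟩) (.inl (hxy.trans hyz))
    rw [← h1] at h4
    change (q ⟨z, hz'⟩ ≫ edgeHom _ ≫ inv (q ⟨y, hy'⟩)) ≫ (q ⟨y, hy'⟩ ≫ edgeHom _ ≫
      inv (q ⟨x, hx'⟩)) = q ⟨z, hz'⟩ ≫ edgeHom _ ≫ inv (q ⟨x, hx'⟩)
    rw [h2, h3, h4]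
    simp
  obtain ⟨d, hd⟩ := hZ _ c hc
  let d' : X → (E ⟶ E) := d
  refine ⟨fun v => inv (d' v.1) ≫ q v, fun v w hv hw h => ?_⟩
  have h1 := hd v.1 hv w.1 hw h
  simp only [c, dif_pos (show v.1 ∈ S ∧ w.1 ∈ S ∧ v.1 ≤ w.1 from ⟨v.2, w.2, h⟩)] at h1
  have h2 := edgeHom_symm (v := v) (w := w) (.inl h)
  have h3 := mul_eq_of_eq_inv_mul h1
  have h4 : (q w ≫ edgeHom (.inr h) ≫ inv (q v)) ≫ d' v.1 = d' w.1 := h3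
  rw [h2] at h4
  beta_reduce
  rw [← h4]
  simp

theorem simplyConnectedSpace_of_posetH1Trivial (hS : PosetConn S) (h1 : PosetH1Trivial S) :
    SimplyConnectedSpace (geomRealOn S) := by
  have := hS.pathConnectedSpace
  refine simply_connected_iff_loops_nullhomotopic.2 ⟨inferInstance, fun x γ => ?_⟩
  obtain ⟨q, hq⟩ := exists_gauge x subset_rfl h1
  have htop : (⊥ : Subgroup (FundamentalGroup (geomRealOn S) x)) = ⊤ := by
    refine eq_top_of_forall_edge_mem q _ fun v w h => ?_
    have h2 := edgeHom_symm (v := v) (w := w) (.inl h)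
    have h3 : q w ≫ edgeHom (.inr h) ≫ inv (q v) = 𝟙 _ := by
      rw [h2, ← hq v w v.2 w.2 h]
      simp
    rw [h3]
    exact (⊥ : Subgroup (FundamentalGroup (geomRealOn S) x)).one_mem
  let g : FundamentalGroup (geomRealOn S) x := Path.Homotopic.Quotient.mk γ
  have hg : g = 1 := by
    have : g ∈ (⊥ : Subgroup (FundamentalGroup (geomRealOn S) x)) := htop ▸ Subgroup.mem_top g
    simpa using this
  exact Path.Homotopic.Quotient.eq.1 hg

end Gauge

section Holonomy

open CategoryTheory unitInterval

variable {X : Type} [PartialOrder X] {S : Set X}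

/-- The principal bundle with discrete structure group over the realization which has prescribed
transition functions between open stars of vertices. -/
noncomputable def holonomyBundle {F : Type} [Group F] [TopologicalSpace F] [DiscreteTopology F]
    (b : S → S → F)
    (hb : ∀ u v w : S, (u ≤ v ∨ v ≤ u) → (v ≤ w ∨ w ≤ v) → (u ≤ w ∨ w ≤ u) →
      b v w * b u v = b u w)
    (idx : geomRealOn S → S) (hidx : ∀ f : geomRealOn S, f.1 (idx f).1 ≠ 0) :
    FiberBundleCore S (geomRealOn S) F where
  baseSet v := {f : geomRealOn S | f.1 v.1 ≠ 0}
  isOpen_baseSet v := isOpen_ne_fun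
    ((continuous_apply v.1).comp continuous_subtype_val) continuous_const
  indexAt := idx
  mem_baseSet_at := hidx
  coordChange v w _ x := b v w * x
  coordChange_self v _ _ x := by
    have h := hb v v v (.inl le_rfl) (.inl le_rfl) (.inl le_rfl)
    rw [mul_eq_left.1 h, one_mul]
  continuousOn_coordChange v w := by
    have : Continuous fun x : F => b v w * x := continuous_of_discreteTopology
    exact (this.comp continuous_snd).continuousOn
  coordChange_comp u v w f hf x := by
    have h := hb u v w (f.2.2.2.1.total hf.1.1 hf.1.2) (f.2.2.2.1.total hf.1.2 hf.2)
      (f.2.2.2.1.total hf.1.1 hf.2)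
    rw [← h, mul_assoc]

variable [Finite X]

/-- A system of transition functions determines a holonomy representation of the fundamental
groupoid. -/
theorem exists_holonomy {F : Type} [Group F] (b : S → S → F)
    (hb : ∀ u v w : S, (u ≤ v ∨ v ≤ u) → (v ≤ w ∨ w ≤ v) → (u ≤ w ∨ w ≤ u) →
      b v w * b u v = b u w) :
    ∃ M : ∀ f g : FundamentalGroupoid (geomRealOn S), (f ⟶ g) → F → F,
      (∀ f x, M f f (𝟙 f) x = x) ∧
      (∀ f g h (α : f ⟶ g) (β : g ⟶ h) x, M f h (α ≫ β) x = M g h β (M f g α x)) ∧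
      ∀ (v w : S) (h : v ≤ w ∨ w ≤ v) x, M _ _ (edgeHom h) x = b v w * x := by
  have hsupp : ∀ f : geomRealOn S, ∃ v : S, f.1 v.1 ≠ 0 := by
    intro f
    obtain ⟨v, hv⟩ := support_nonempty_of_mem_geomRealOn f.2
    exact ⟨⟨v, f.2.2.1 hv⟩, hv⟩
  choose idx hidx using hsupp
  let _ : TopologicalSpace F := ⊥
  have : DiscreteTopology F := ⟨rfl⟩
  let Z := holonomyBundle b hb idx hidx
  have cov : IsCoveringMap (Bundle.TotalSpace.proj : Bundle.TotalSpace F Z.Fiber → geomRealOn S) :=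
    FiberBundle.isCoveringMap
  let M : ∀ f g : FundamentalGroupoid (geomRealOn S), (f ⟶ g) → F → F := fun f g γ x =>
    (cov.monodromy γ ⟨⟨f.as, x⟩, rfl⟩).1.snd
  have hid : ∀ f x, M f f (𝟙 f) x = x := by
    intro f x
    have := congrFun (cov.monodromy_refl (x := f.as)) ⟨⟨f.as, x⟩, rfl⟩
    exact congrArg (fun e => (e.1.snd : F)) this
  have hcomp : ∀ f g h (α : f ⟶ g) (β : g ⟶ h) x, M f h (α ≫ β) x = M g h β (M f g α x) := by
    intro f g h α β x
    have h1 := cov.monodromy_trans_apply α β ⟨⟨f.as, x⟩, rfl⟩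
    have h2 : ∀ e : (Bundle.TotalSpace.proj : Bundle.TotalSpace F Z.Fiber → geomRealOn S) ⁻¹'
        {g.as}, (⟨⟨g.as, e.1.snd⟩, rfl⟩ : (Bundle.TotalSpace.proj :
          Bundle.TotalSpace F Z.Fiber → geomRealOn S) ⁻¹' {g.as}) = e := by
      rintro ⟨⟨g', y⟩, hg⟩
      obtain ⟨g⟩ := g
      have hg' : g' = g := hg
      subst hg'
      rfl
    have h3 := h2 (cov.monodromy α ⟨⟨f.as, x⟩, rfl⟩)
    have h4 : cov.monodromy β (cov.monodromy α ⟨⟨f.as, x⟩, rfl⟩) =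
      cov.monodromy β ⟨⟨g.as, M f g α x⟩, rfl⟩ := congrArg _ h3.symm
    exact congrArg (fun e => (e.1.snd : F)) (h1.trans h4)
  have hself : ∀ v, b v v = 1 := fun v =>
    mul_eq_left.1 (hb v v v (.inl le_rfl) (.inl le_rfl) (.inl le_rfl))
  have hlocal : ∀ (f g : geomRealOn S) (γ : Path f g) (v : S) (_ : ∀ t, (γ t).1 v.1 ≠ 0) (x : F),
      M _ _ (Path.Homotopic.Quotient.mk γ :
        FundamentalGroupoid.mk f ⟶ FundamentalGroupoid.mk g) (b v (idx f) * x) =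
        b v (idx g) * x := by
    intro f g γ v hγ x
    let Γ : Path (⟨f, b v (idx f) * x⟩ : Bundle.TotalSpace F Z.Fiber) ⟨g, b v (idx g) * x⟩ :=
      { toFun := fun t => (Z.localTriv v).toOpenPartialHomeomorph.symm (γ t, x)
        continuous_toFun := by
          refine (Z.localTriv v).toOpenPartialHomeomorph.continuousOn_symm.comp_continuous
            (by fun_prop) fun t => ?_
          exact (Z.mem_localTriv_target v _).2 (hγ t)
        source' := by
          rw [Z.localTriv_symm_apply, γ.source]
          rfl
        target' := by
          rw [Z.localTriv_symm_apply, γ.target]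
          rfl }
    have := cov.monodromy_map (Path.Homotopic.Quotient.mk Γ)
    exact congrArg (fun e => (e.1.snd : F)) this
  have hspoke : ∀ (v : S) (f : geomRealOn S) (h : f.1 v.1 ≠ 0) (x : F),
      M _ _ (spokeHom h) x = b v (idx f) * x := by
    intro v f h x
    have hC : IsChain (· ≤ ·) ({v} : Set S) := Set.subsingleton_singleton.isChain
    have hseg : ∀ t : I, AffineMap.lineMap (geomVertex v).1 f.1 (t : ℝ) ∈ chainStar {v} := by
      intro t
      have := (starConvex_chainStar hC (Set.mem_singleton v)).add_smul_sub_mem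
        (mem_chainStar_singleton h) t.2.1 t.2.2
      rwa [AffineMap.lineMap_apply_module', add_comm]
    let γ : Path (geomVertex v) f :=
      { toFun := fun t => ⟨AffineMap.lineMap (geomVertex v).1 f.1 (t : ℝ), (hseg t).1⟩
        continuous_toFun := by
          refine Continuous.subtype_mk ?_ _
          exact AffineMap.lineMap_continuous.comp continuous_subtype_val
        source' := by simp
        target' := by simp }
    have h1 : Path.Homotopic.Quotient.mk γ = spokeHom h :=
      mk_eq_starHom hC (by simp) _ _ γ hseg
    have h2 := hlocal _ _ γ v (fun t => ?_) x
    · have h3 : idx (geomVertex v) = v := Subtype.ext (eq_of_geomVertex_apply_ne_zero (hidx _))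
      rw [h3, hself, one_mul] at h2
      rw [← h2, ← h1]
    · have h4 := geomVertex_apply_pos v
      have h5 : 0 < f.1 v.1 := lt_of_le_of_ne (f.2.1 _) h.symm
      have h6 : (γ t).1 v.1 = (1 - t) * (geomVertex v).1 v.1 + t * f.1 v.1 := by
        simp [γ, AffineMap.lineMap_apply_module]
      rw [h6]
      rcases eq_or_lt_of_le t.2.2 with h7 | h7
      · simp [h7, h]
      · have := t.2.1
        have : 0 < 1 - (t : ℝ) := by linarith
        positivity
  refine ⟨M, hid, hcomp, fun v w h x => ?_⟩
  obtain ⟨m, hv, hw⟩ : ∃ m : geomRealOn S, m.1 v.1 ≠ 0 ∧ m.1 w.1 ≠ 0 := by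
    have h1 := (starConvex_chainStar (isChain_pair h) (v := v) (by simp))
      (geomVertex_mem_chainStar (isChain_pair h) (v := w) (by simp))
      (show (0 : ℝ) ≤ 1 / 2 by norm_num) (show (0 : ℝ) ≤ 1 / 2 by norm_num) (by norm_num)
    refine ⟨⟨_, h1.1⟩, ?_, ?_⟩
    · have := geomVertex_apply_pos v
      have := (geomVertex w).2.1 v.1
      simp only [Pi.add_apply, Pi.smul_apply, smul_eq_mul]
      positivity
    · have := geomVertex_apply_pos w
      have := (geomVertex v).2.1 w.1
      simp only [Pi.add_apply, Pi.smul_apply, smul_eq_mul]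
      positivity
  have h1 := hcomp _ _ _ (edgeHom (m.2.2.2.1.total hv hw)) (spokeHom hw) x
  rw [edgeHom_comp_spokeHom hv hw, hspoke, hspoke] at h1
  have h2 := hb v w (idx m) h (m.2.2.2.1.total hw (hidx m)) (m.2.2.2.1.total hv (hidx m))
  rw [← h2, mul_assoc] at h1
  exact (mul_left_cancel h1).symm

end Holonomy

section FreeFundamentalGroup

open CategoryTheory

variable {X : Type} [PartialOrder X] [Finite X] {S : Set X}

/-- The connected components of the part of `Z` lying above `a`. -/
def UpperComponents (Z : Set X) (a : X) : Type :=
  Quot fun w w' : {w : X // w ∈ Z ∧ a ≤ w} => w.1 ≤ w'.1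

open Classical in
/-- The fundamental group of a poset obtained from a simply connected one by adding cones over
disconnected subposets is free. -/
theorem exists_fundamentalGroup_equiv_freeGroup {Z : Set X} (hZS : Z ⊆ S) (hZ : PosetConn Z)
    (hZ1 : PosetH1Trivial Z) (hmin : ∀ a ∈ S \ Z, ∀ v ∈ S, v ≤ a → v = a)
    (hlink : ∀ a ∈ S \ Z, ∃ w ∈ Z, a ≤ w) (x : geomRealOn S) :
    ∃ T : Type, Nonempty (FundamentalGroup (geomRealOn S) x ≃* FreeGroup T) := by
  have hconn : PosetConn S := by
    refine ⟨hZ.1.mono hZS, fun P hP x hx y hy hPx => ?_⟩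
    have key : ∀ x ∈ S, ∃ z ∈ Z, (P x ↔ P z) := by
      intro x hx
      by_cases hxZ : x ∈ Z
      · exact ⟨x, hxZ, Iff.rfl⟩
      · obtain ⟨w, hw, h⟩ := hlink x ⟨hx, hxZ⟩
        exact ⟨w, hw, hP x hx w (hZS hw) h⟩
    obtain ⟨z, hz, h⟩ := key x hx
    obtain ⟨z', hz', h'⟩ := key y hy
    exact h'.2 (hZ.2 P (fun x hx y hy => hP x (hZS hx) y (hZS hy)) z hz z' hz' (h.1 hPx))
  have := hconn.pathConnectedSpace
  obtain ⟨z₀, hz₀⟩ := hZ.1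
  let x₀ : geomRealOn S := geomVertex ⟨z₀, hZS hz₀⟩
  suffices h : ∃ T : Type, Nonempty (FundamentalGroup (geomRealOn S) x₀ ≃* FreeGroup T) by
    obtain ⟨T, ⟨e⟩⟩ := h
    exact ⟨T, ⟨(FundamentalGroup.fundamentalGroupMulEquivOfPathConnected x x₀).trans e⟩⟩
  obtain ⟨q, hq⟩ := exists_gauge x₀ hZS hZ1
  choose! up hupZ hup using hlink
  let base : ∀ a : ↥(S \ Z), UpperComponents Z a.1 := fun a =>
    Quot.mk _ ⟨up a.1, hupZ a.1 a.2, hup a.1 a.2⟩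
  let Gen : Type := {k : (a : ↥(S \ Z)) × UpperComponents Z a.1 // k.2 ≠ base k.1}
  let vA : ↥(S \ Z) → S := fun a => ⟨a.1, a.2.1⟩
  -- the connection from the base point to `a` through a component
  let ray : ∀ a : ↥(S \ Z), UpperComponents Z a.1 →
      (FundamentalGroupoid.mk x₀ ⟶ FundamentalGroupoid.mk (geomVertex (vA a))) := fun a =>
    Quot.lift (fun w => q ⟨w.1, hZS w.2.1⟩ ≫ edgeHom (w := vA a) (.inr w.2.2)) (by
      rintro ⟨w, hw, haw⟩ ⟨w', hw', haw'⟩ hww'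
      have h1 := hq ⟨w, hZS hw⟩ ⟨w', hZS hw'⟩ hw hw' hww'
      have h2 := edgeHom_comp (u := vA a) (v := ⟨w, hZS hw⟩) (w := ⟨w', hZS hw'⟩) haw hww'
      have h3 := edgeHom_symm (v := vA a) (w := ⟨w, hZS hw⟩) (.inl haw)
      have h4 := edgeHom_symm (v := vA a) (w := ⟨w', hZS hw'⟩) (.inl haw')
      dsimp only
      rw [h3, h4, ← h2, ← h1]
      simp)
  let loop : Gen → FundamentalGroup (geomRealOn S) x₀ := fun k =>
    ray k.1.1 (base k.1.1) ≫ inv (ray k.1.1 k.1.2)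
  let ψ : FreeGroup Gen →* FundamentalGroup (geomRealOn S) x₀ := FreeGroup.lift loop
  have hsurj : ψ.range = ⊤ := by
    let q' : ∀ v : S, FundamentalGroupoid.mk x₀ ⟶ FundamentalGroupoid.mk (geomVertex v) :=
      fun v => if h : v.1 ∈ Z then q v else ray ⟨v.1, v.2, h⟩ (base ⟨v.1, v.2, h⟩)
    refine eq_top_of_forall_edge_mem q' _ fun v w hvw => ?_
    have hsymm := edgeHom_symm (v := v) (w := w) (.inl hvw)
    by_cases hv : v.1 ∈ Z
    · by_cases hw : w.1 ∈ Z
      · have h1 : q' w ≫ edgeHom (.inr hvw) ≫ inv (q' v) = 𝟙 _ := by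
          simp only [q', dif_pos hv, dif_pos hw]
          rw [hsymm, ← hq v w hv hw hvw]
          simp
        rw [h1]
        exact ψ.range.one_mem
      · have := hmin w.1 ⟨w.2, hw⟩ v.1 v.2 hvw
        exact absurd (this ▸ hv) hw
    · by_cases hw : w.1 ∈ Z
      · let a : ↥(S \ Z) := ⟨v.1, v.2, hv⟩
        let k : UpperComponents Z a.1 := Quot.mk _ ⟨w.1, hw, hvw⟩
        have h1 : q' w ≫ edgeHom (.inr hvw) ≫ inv (q' v) = ray a k ≫ inv (ray a (base a)) := by
          simp only [q', dif_neg hv, dif_pos hw]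
          rw [← Category.assoc]
        rw [h1]
        by_cases hk : k = base a
        · rw [hk]
          have : ray a (base a) ≫ inv (ray a (base a)) = 𝟙 _ := by simp
          rw [this]
          exact ψ.range.one_mem
        · have h2 : ψ (FreeGroup.of ⟨⟨a, k⟩, hk⟩)⁻¹ =
              (ray a k ≫ inv (ray a (base a)) : FundamentalGroup (geomRealOn S) x₀) := by
            rw [map_inv, FreeGroup.lift_apply_of]
            refine inv_eq_of_mul_eq_one_left ?_
            change (ray a (base a) ≫ inv (ray a k)) ≫ (ray a k ≫ inv (ray a (base a))) = 𝟙 _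
            simp
          exact ⟨_, h2⟩
      · obtain rfl : v = w := Subtype.ext (hmin w.1 ⟨w.2, hw⟩ v.1 v.2 hvw)
        have h1 : edgeHom (.inl hvw) = 𝟙 (FundamentalGroupoid.mk (geomVertex v)) := by
          have := edgeHom_comp hvw hvw
          exact (cancel_epi_id _).1 this
        have h2 : q' v ≫ edgeHom (.inr hvw) ≫ inv (q' v) = 𝟙 _ := by
          rw [h1]
          simp
        rw [h2]
        exact ψ.range.one_mem
  have hinj : Injective ψ := by
    let φ : ∀ a : ↥(S \ Z), UpperComponents Z a.1 → FreeGroup Gen := fun a k =>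
      if h : k = base a then 1 else FreeGroup.of ⟨⟨a, k⟩, h⟩
    let g : S → S → FreeGroup Gen := fun v w =>
      if h : v.1 ∉ Z ∧ w.1 ∈ Z ∧ v.1 ≤ w.1 then
        φ ⟨v.1, v.2, h.1⟩ (Quot.mk _ ⟨w.1, h.2.1, h.2.2⟩)
      else 1
    have hgZ : ∀ v w : S, v.1 ∈ Z → g v w = 1 := fun v w hv => dif_neg fun h => h.1 hv
    have hgcomp : ∀ v w w' : S, v.1 ∉ Z → w.1 ∈ Z → w'.1 ∈ Z → v.1 ≤ w.1 → w.1 ≤ w'.1 →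
        g v w = g v w' := by
      intro v w w' hv hw hw' hvw hww'
      simp only [g]
      rw [dif_pos ⟨hv, hw, hvw⟩, dif_pos ⟨hv, hw', hvw.trans hww'⟩]
      exact congrArg _ (Quot.sound hww')
    have hAle : ∀ v w : S, v.1 ∉ Z → (v ≤ w ∨ w ≤ v) → v.1 ≤ w.1 := by
      intro v w hv h
      rcases h with h | h
      · exact h
      · exact (hmin v.1 ⟨v.2, hv⟩ w.1 w.2 h).ge
    have hAeq : ∀ v w : S, v.1 ∉ Z → w.1 ∉ Z → (v ≤ w ∨ w ≤ v) → v = w := by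
      intro v w hv hw h
      exact Subtype.ext (hmin w.1 ⟨w.2, hw⟩ v.1 v.2 (hAle v w hv h))
    have hgcomp' : ∀ v w w' : S, v.1 ∉ Z → w.1 ∈ Z → w'.1 ∈ Z → (v ≤ w ∨ w ≤ v) →
        (v ≤ w' ∨ w' ≤ v) → (w ≤ w' ∨ w' ≤ w) → g v w = g v w' := by
      intro v w w' hv hw hw' hvw hvw' hww'
      rcases hww' with h | h
      · exact hgcomp v w w' hv hw hw' (hAle v w hv hvw) h
      · exact (hgcomp v w' w hv hw' hw (hAle v w' hv hvw') h).symm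
    let b : S → S → FreeGroup Gen := fun v w => g v w * (g w v)⁻¹
    have hb : ∀ u v w : S, (u ≤ v ∨ v ≤ u) → (v ≤ w ∨ w ≤ v) → (u ≤ w ∨ w ≤ u) →
        b v w * b u v = b u w := by
      intro u v w huv hvw huw
      simp only [b]
      by_cases hu : u.1 ∈ Z <;> by_cases hv : v.1 ∈ Z <;> by_cases hw : w.1 ∈ Z
      · simp [hgZ, hu, hv, hw]
      · simp [hgZ u _ hu, hgZ v _ hv, hgcomp' w u v hw hu hv huw.symm hvw.symm huv]
      · simp [hgZ u _ hu, hgZ w _ hw, hgcomp' v u w hv hu hw huv.symm hvw huw]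
      · obtain rfl := hAeq v w hv hw hvw
        simp
      · simp [hgZ v _ hv, hgZ w _ hw, hgcomp' u v w hu hv hw huv huw hvw]
      · obtain rfl := hAeq u w hu hw huw
        simp
      · obtain rfl := hAeq u v hu hv huv
        simp
      · obtain rfl := hAeq u v hu hv huv
        simp
    obtain ⟨M, hMid, hMcomp, hMedge⟩ := exists_holonomy b hb
    let e : FundamentalGroupoid (geomRealOn S) := FundamentalGroupoid.mk x₀
    let τ : FreeGroup Gen → FreeGroup Gen := M _ _ (q ⟨z₀, hZS hz₀⟩)
    have hτ : ∀ v : S, v.1 ∈ Z → ∀ y, M _ _ (q v) y = τ y := by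
      intro v hv y
      refine (hZ.2 (fun z => ∃ h : z ∈ S, M _ _ (q ⟨z, h⟩) y = τ y) ?_ z₀ hz₀ v.1 hv
        ⟨hZS hz₀, rfl⟩).2
      intro z hz z' hz' hzz'
      have h1 := hMcomp _ _ _ (q ⟨z, hZS hz⟩)
        (edgeHom (v := ⟨z, hZS hz⟩) (w := (⟨z', hZS hz'⟩ : S)) (.inl hzz')) y
      rw [hq ⟨z, hZS hz⟩ ⟨z', hZS hz'⟩ hz hz' hzz', hMedge] at h1
      have h2 : b ⟨z, hZS hz⟩ ⟨z', hZS hz'⟩ = 1 := by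
        simp only [b]
        rw [hgZ ⟨z, hZS hz⟩ _ hz, hgZ ⟨z', hZS hz'⟩ _ hz', inv_one, mul_one]
      rw [h2, one_mul] at h1
      exact ⟨fun h => ⟨hZS hz', h1.trans h.2⟩, fun h => ⟨hZS hz, h1.symm.trans h.2⟩⟩
    have hray : ∀ a k y, M _ _ (ray a k) y = (φ a k)⁻¹ * τ y := by
      intro a k y
      induction k using Quot.ind with
      | mk w =>
        have h1 := hMcomp _ _ _ (q ⟨w.1, hZS w.2.1⟩)
          (edgeHom (w := vA a) (.inr w.2.2)) y
        rw [hMedge, hτ ⟨w.1, hZS w.2.1⟩ w.2.1] at h1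
        have h2 : b ⟨w.1, hZS w.2.1⟩ (vA a) = (φ a (Quot.mk _ w))⁻¹ := by
          simp only [b, hgZ ⟨w.1, hZS w.2.1⟩ _ w.2.1, one_mul]
          congr 1
          exact dif_pos ⟨a.2.2, w.2.1, w.2.2⟩
        rw [h2] at h1
        exact h1
    have hloop : ∀ k y, τ (M e e (loop k) y) = FreeGroup.of k * τ y := by
      intro k y
      have h1 : (loop k : e ⟶ e) ≫ ray k.1.1 k.1.2 = ray k.1.1 (base k.1.1) := by
        change (ray k.1.1 (base k.1.1) ≫ inv (ray k.1.1 k.1.2)) ≫ ray k.1.1 k.1.2 = _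
        simp
      have h2 := hMcomp _ _ _ (loop k : e ⟶ e) (ray k.1.1 k.1.2) y
      rw [h1] at h2
      have h5 := (hray k.1.1 (base k.1.1) y).symm.trans (h2.trans (hray _ k.1.2 _))
      have h3 : φ k.1.1 (base k.1.1) = 1 := dif_pos rfl
      have h4 : φ k.1.1 k.1.2 = FreeGroup.of k := dif_neg k.2
      rw [h3, h4, inv_one, one_mul] at h5
      rw [h5, mul_inv_cancel_left]
    have hψ : ∀ w y, τ (M e e (ψ w) y) = w * τ y := by
      intro w
      induction w using FreeGroup.induction_on with
      | C1 =>
        intro y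
        rw [map_one, one_mul]
        exact congrArg τ (hMid e y)
      | of k =>
        intro y
        rw [FreeGroup.lift_apply_of]
        exact hloop k y
      | inv_of k ih =>
        intro y
        rw [eq_inv_mul_iff_mul_eq, ← ih]
        have h1 : ψ (FreeGroup.of k) * ψ (FreeGroup.of k)⁻¹ = 1 := by
          rw [← map_mul, mul_inv_cancel, map_one]
        have h2 := hMcomp e e e (ψ (FreeGroup.of k)⁻¹) (ψ (FreeGroup.of k)) y
        have h3 : M e e (ψ (FreeGroup.of k) * ψ (FreeGroup.of k)⁻¹) y = y := by
          rw [h1]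
          exact hMid e y
        exact congrArg τ (h2.symm.trans h3)
      | mul v w hv hw =>
        intro y
        rw [map_mul, mul_assoc, ← hw, ← hv]
        exact congrArg τ (hMcomp _ _ _ _ _ _)
    rw [injective_iff_map_eq_one]
    intro w hw
    have h1 := hψ w 1
    rw [hw] at h1
    have h2 : τ (M e e (1 : FundamentalGroup (geomRealOn S) x₀) 1) = τ 1 :=
      congrArg τ (hMid e 1)
    exact mul_eq_right.1 (h1.symm.trans h2)
  exact ⟨Gen, ⟨(MulEquiv.ofBijective ψ ⟨hinj, MonoidHom.range_eq_top.1 hsurj⟩).symm⟩⟩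

end FreeFundamentalGroup

section PosetExtension

variable {X : Type} [PartialOrder X] {S T : Set X}

theorem PosetConn.of_forall_exists (hTS : T ⊆ S) (hT : PosetConn T)
    (h : ∀ x ∈ S, ∃ t ∈ T, x ≤ t ∨ t ≤ x) : PosetConn S := by
  refine ⟨hT.1.mono hTS, fun P hP x hx y hy hPx => ?_⟩
  have key : ∀ x ∈ S, ∃ t ∈ T, (P x ↔ P t) := by
    intro x hx
    obtain ⟨t, ht, h | h⟩ := h x hx
    · exact ⟨t, ht, hP x hx t (hTS ht) h⟩
    · exact ⟨t, ht, (hP t (hTS ht) x hx h).symm⟩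
  obtain ⟨z, hz, h⟩ := key x hx
  obtain ⟨z', hz', h'⟩ := key y hy
  exact h'.2 (hT.2 P (fun x hx y hy => hP x (hTS hx) y (hTS hy)) z hz z' hz' (h.1 hPx))

theorem PosetConn.eq_of_forall_le {α : Type*} (hT : PosetConn T) (f : X → α)
    (hf : ∀ x ∈ T, ∀ y ∈ T, x ≤ y → f x = f y) {x y : X} (hx : x ∈ T) (hy : y ∈ T) :
    f x = f y :=
  hT.2 (fun z => f x = f z) (fun u hu v hv huv => by rw [hf u hu v hv huv]) x hx y hy rfl

/-- Adding an antichain of elements with connected links preserves the vanishing of the first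
cohomology. -/
theorem PosetH1Trivial.of_links (hTS : T ⊆ S) (hT : PosetH1Trivial T)
    (hanti : ∀ a ∈ S \ T, ∀ b ∈ S \ T, a ≤ b → a = b)
    (hlink : ∀ a ∈ S \ T, PosetConn {t | t ∈ T ∧ (t ≤ a ∨ a ≤ t)}) : PosetH1Trivial S := by
  classical
  intro H _ c hc
  obtain ⟨d₀, hd₀⟩ := hT H c fun x hx y hy z hz => hc x (hTS hx) y (hTS hy) z (hTS hz)
  let κ : X → X → H := fun a t => if t ≤ a then d₀ t * c t a else d₀ t * (c a t)⁻¹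
  have hκ : ∀ a ∈ S \ T, ∀ t ∈ T, (t ≤ a ∨ a ≤ t) → ∀ t' ∈ T, (t' ≤ a ∨ a ≤ t') →
      κ a t = κ a t' := by
    intro a ha t ht hta t' ht' ht'a
    refine (hlink a ha).eq_of_forall_le (κ a) ?_ ⟨ht, hta⟩ ⟨ht', ht'a⟩
    rintro t ⟨ht, hta⟩ t' ⟨ht', ht'a⟩ htt'
    have h1 := hd₀ t ht t' ht' htt'
    simp only [κ]
    by_cases h2 : t' ≤ a
    · rw [if_pos h2, if_pos (htt'.trans h2), ← hc t (hTS ht) t' (hTS ht') a ha.1 htt' h2, h1]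
      group
    · have h3 := ht'a.resolve_left h2
      by_cases h4 : t ≤ a
      · rw [if_pos h4, if_neg h2]
        rw [← hc t (hTS ht) a ha.1 t' (hTS ht') h4 h3] at h1
        rw [eq_inv_mul_iff_mul_eq] at h1
        rw [← h1]
        group
      · have h5 := hta.resolve_left h4
        rw [if_neg h4, if_neg h2, ← hc a ha.1 t (hTS ht) t' (hTS ht') h5 htt', h1]
        group
  choose! τ hτ hτ' using fun a (ha : a ∈ S \ T) => (hlink a ha).1
  let d : X → H := fun x => if x ∈ T then d₀ x else κ x (τ x)
  refine ⟨d, fun x hx y hy hxy => ?_⟩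
  have hd : ∀ a ∈ S \ T, ∀ t ∈ T, (t ≤ a ∨ a ≤ t) → d a = κ a t := by
    intro a ha t ht hta
    simp only [d, if_neg ha.2]
    exact hκ a ha _ (hτ a ha) (hτ' a ha) t ht hta
  by_cases hxT : x ∈ T <;> by_cases hyT : y ∈ T
  · simp only [d, if_pos hxT, if_pos hyT]
    exact hd₀ x hxT y hyT hxy
  · rw [hd y ⟨hy, hyT⟩ x hxT (.inl hxy)]
    simp only [d, κ, if_pos hxT, if_pos hxy]
    group
  · have h1 : ¬ y ≤ x := fun h => hxT (le_antisymm h hxy ▸ hyT)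
    rw [hd x ⟨hx, hxT⟩ y hyT (.inr hxy)]
    simp only [d, κ, if_pos hyT, if_neg h1]
    group
  · obtain rfl := hanti x ⟨hx, hxT⟩ y ⟨hy, hyT⟩ hxy
    rw [hc.self hx]
    group

/-- A poset retracting downwards onto a connected subposet is connected. -/
theorem PosetConn.of_retract (hTS : T ⊆ S) (hT : PosetConn T) (r : X → X)
    (hr : ∀ x ∈ S, r x ∈ T) (hle : ∀ x ∈ S, r x ≤ x) : PosetConn S :=
  hT.of_forall_exists hTS fun x hx => ⟨r x, hr x hx, .inr (hle x hx)⟩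

theorem PosetH1Trivial.of_retract (hTS : T ⊆ S) (hT : PosetH1Trivial T) (r : X → X)
    (hr : ∀ x ∈ S, r x ∈ T) (hle : ∀ x ∈ S, r x ≤ x)
    (hmono : ∀ x ∈ S, ∀ y ∈ S, x ≤ y → r x ≤ r y) : PosetH1Trivial S := by
  intro H _ c hc
  obtain ⟨d₀, hd₀⟩ := hT H c fun x hx y hy z hz => hc x (hTS hx) y (hTS hy) z (hTS hz)
  refine ⟨fun x => d₀ (r x) * c (r x) x, fun x hx y hy hxy => ?_⟩
  have h1 := hd₀ _ (hr x hx) _ (hr y hy) (hmono x hx y hy hxy)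
  have h2 := hc _ (hTS (hr x hx)) _ (hTS (hr y hy)) y hy (hmono x hx y hy hxy) (hle y hy)
  have h3 := hc _ (hTS (hr x hx)) x hx y hy (hle x hx) hxy
  rw [← h3, h1] at h2
  rw [← mul_right_inj (c (r x) x), ← h2]
  group

end PosetExtension

section TripleJoin

/-- A cocycle on the join of three nonempty sets is a coboundary. -/
theorem exists_primitive_of_triple {X H : Type} [Group H] (W : Fin 3 → Set X)
    (hne : ∀ i, (W i).Nonempty) (e : X → X → H)
    (hsymm : ∀ i j, i ≠ j → ∀ x ∈ W i, ∀ y ∈ W j, e x y * e y x = 1)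
    (hcomp : ∀ i j k, i ≠ j → j ≠ k → i ≠ k → ∀ x ∈ W i, ∀ y ∈ W j, ∀ z ∈ W k,
      e x y * e y z = e x z) :
    ∃ d : Fin 3 → X → H, ∀ i j, i ≠ j → ∀ x ∈ W i, ∀ y ∈ W j, e x y = (d i x)⁻¹ * d j y := by
  choose w hw using hne
  let d : Fin 3 → X → H := fun i x => if i = 0 then e (w 0) (w 1) * e (w 1) x else e (w 0) x
  have hind2 : ∀ x ∈ W 0, ∀ v ∈ W 2, e (w 0) v * e v x = e (w 0) (w 1) * e (w 1) x := by
    intro x hx v hv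
    rw [← hcomp 0 1 2 (by decide) (by decide) (by decide) _ (hw 0) _ (hw 1) v hv, mul_assoc,
      hcomp 1 2 0 (by decide) (by decide) (by decide) _ (hw 1) v hv x hx]
  have hind1 : ∀ x ∈ W 0, ∀ v ∈ W 1, e (w 0) v * e v x = e (w 0) (w 1) * e (w 1) x := by
    intro x hx v hv
    rw [← hind2 x hx _ (hw 2), ← hcomp 0 2 1 (by decide) (by decide) (by decide) _ (hw 0) _ (hw 2)
      v hv, mul_assoc, hcomp 2 1 0 (by decide) (by decide) (by decide) _ (hw 2) v hv x hx]
  have h10 : ∀ x ∈ W 1, ∀ y ∈ W 0, e x y = (d 1 x)⁻¹ * d 0 y := by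
    intro x hx y hy
    simp only [d, if_pos, if_neg (show (1 : Fin 3) ≠ 0 by decide)]
    rw [← hind1 y hy x hx]
    group
  have h20 : ∀ x ∈ W 2, ∀ y ∈ W 0, e x y = (d 2 x)⁻¹ * d 0 y := by
    intro x hx y hy
    simp only [d, if_pos, if_neg (show (2 : Fin 3) ≠ 0 by decide)]
    rw [← hind2 y hy x hx]
    group
  have h12 : ∀ x ∈ W 1, ∀ y ∈ W 2, e x y = (d 1 x)⁻¹ * d 2 y := by
    intro x hx y hy
    simp only [d, if_neg (show (1 : Fin 3) ≠ 0 by decide), if_neg (show (2 : Fin 3) ≠ 0 by decide)]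
    rw [← hcomp 0 1 2 (by decide) (by decide) (by decide) _ (hw 0) x hx y hy]
    group
  have hflip : ∀ i j, i ≠ j → (∀ x ∈ W i, ∀ y ∈ W j, e x y = (d i x)⁻¹ * d j y) →
      ∀ y ∈ W j, ∀ x ∈ W i, e y x = (d j y)⁻¹ * d i x := by
    intro i j hij h y hy x hx
    rw [← mul_right_inj (e x y), hsymm i j hij x hx y hy, h x hx y hy]
    group
  refine ⟨d, fun i j hij => ?_⟩
  fin_cases i <;> fin_cases j
  · exact absurd rfl hij
  · exact hflip 1 0 (by decide) h10
  · exact hflip 2 0 (by decide) h20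
  · exact h10
  · exact absurd rfl hij
  · exact h12
  · exact h20
  · exact hflip 1 2 (by decide) h12
  · exact absurd rfl hij

variable {X : Type} [SemilatticeSup X] {S : Set X}

/-- A poset that contracts onto the join of three nonempty posets is simply connected in the
combinatorial sense. -/
theorem posetConn_and_posetH1Trivial_of_triple (W : Fin 3 → Set X) (hne : ∀ i, (W i).Nonempty)
    (hWS : ∀ i, W i ⊆ S)
    (hsup : ∀ i j, i ≠ j → ∀ x ∈ W i, ∀ y ∈ W j, x ⊔ y ∈ S)
    (hsup3 : ∀ i j k, i ≠ j → j ≠ k → i ≠ k → ∀ x ∈ W i, ∀ y ∈ W j, ∀ z ∈ W k, x ⊔ y ⊔ z ∈ S)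
    (r : X → X) (π : Fin 3 → X → X) (hrS : ∀ x ∈ S, r x ∈ S) (hr : ∀ x ∈ S, x ≤ r x)
    (hrmono : ∀ x ∈ S, ∀ y ∈ S, x ≤ y → r x ≤ r y) (hπr : ∀ x ∈ S, ∀ i, π i x ≤ r x)
    (hπmono : ∀ x ∈ S, ∀ y ∈ S, x ≤ y → ∀ i, π i x ≤ π i y)
    (hπW : ∀ x ∈ S, ∀ y ∈ S, x ≤ y → ∀ i, π i x ∈ W i → π i y ∈ W i)
    (hπ : ∀ x ∈ S, ∃ i, π i x ∈ W i) : PosetConn S ∧ PosetH1Trivial S := by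
  have hother : ∀ i : Fin 3, ∃ j, i ≠ j := by decide
  have hother2 : ∀ i j : Fin 3, ∃ k, j ≠ k ∧ i ≠ k := by decide
  constructor
  · obtain ⟨x₀, hx₀⟩ := hne 0
    refine ⟨⟨x₀, hWS 0 hx₀⟩, fun P hP x hx y hy hPx => ?_⟩
    have hW : ∀ i j, i ≠ j → ∀ x ∈ W i, ∀ y ∈ W j, (P x ↔ P y) := by
      intro i j hij x hx y hy
      have h := hsup i j hij x hx y hy
      rw [hP x (hWS i hx) _ h le_sup_left, hP y (hWS j hy) _ h le_sup_right]
    obtain ⟨i, hi⟩ := hπ x hx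
    obtain ⟨j, hj⟩ := hπ y hy
    obtain ⟨k, hjk, hik⟩ := hother2 i j
    obtain ⟨z, hz⟩ := hne k
    have h1 : ∀ x ∈ S, ∀ i, π i x ∈ W i → (P x ↔ P (π i x)) := by
      intro x hx i hi
      rw [hP x hx _ (hrS x hx) (hr x hx), hP _ (hWS i hi) _ (hrS x hx) (hπr x hx i)]
    rw [h1 y hy j hj, hW j k hjk _ hj z hz, ← hW i k hik _ hi z hz, ← h1 x hx i hi]
    exact hPx
  · intro H _ c hc
    let e : X → X → H := fun x y => c x (x ⊔ y) * (c y (x ⊔ y))⁻¹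
    have hup : ∀ x ∈ S, ∀ y ∈ S, x ⊔ y ∈ S → ∀ z ∈ S, x ⊔ y ≤ z → e x y = c x z * (c y z)⁻¹ := by
      intro x hx y hy hxy z hz hle
      rw [← hc x hx _ hxy z hz le_sup_left hle, ← hc y hy _ hxy z hz le_sup_right hle]
      simp only [e]
      group
    obtain ⟨d, hd⟩ := exists_primitive_of_triple W hne e
      (fun i j hij x hx y hy => by
        simp only [e, sup_comm y x]
        group)
      (fun i j k hij hjk hik x hx y hy z hz => by
        have h := hsup3 i j k hij hjk hik x hx y hy z hz
        rw [hup x (hWS i hx) y (hWS j hy) (hsup i j hij x hx y hy) _ h le_sup_left,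
          hup y (hWS j hy) z (hWS k hz) (hsup j k hjk y hy z hz) _ h
            (by rw [sup_assoc]; exact le_sup_right),
          hup x (hWS i hx) z (hWS k hz) (hsup i k hik x hx z hz) _ h
            (sup_le (le_sup_left.trans le_sup_left) le_sup_right)]
        group)
    have hdW : ∀ i, ∀ x ∈ W i, ∀ y ∈ W i, x ≤ y → c x y = (d i x)⁻¹ * d i y := by
      intro i x hx y hy hxy
      obtain ⟨j, hij⟩ := hother i
      obtain ⟨u, hu⟩ := hne j
      have h1 := hd i j hij x hx u hu
      have h2 := hd i j hij y hy u hu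
      have hyu := hsup i j hij y hy u hu
      rw [hup x (hWS i hx) u (hWS j hu) (hsup i j hij x hx u hu) _ hyu
        (sup_le_sup_right hxy u), ← hc x (hWS i hx) y (hWS i hy) _ hyu hxy le_sup_left,
        mul_assoc] at h1
      change c x y * e y u = _ at h1
      rw [h2, ← mul_assoc, mul_left_inj] at h1
      rw [← h1]
      group
    choose! ι hι using hπ
    have hindep : ∀ x ∈ S, ∀ i, π i x ∈ W i →
        d (ι x) (π (ι x) x) * c (π (ι x) x) (r x) = d i (π i x) * c (π i x) (r x) := by
      intro x hx i hi
      by_cases hij : ι x = i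
      · rw [hij]
      · have h1 := hd _ _ hij _ (hι x hx) _ hi
        rw [hup _ (hWS _ (hι x hx)) _ (hWS i hi) (hsup _ _ hij _ (hι x hx) _ hi) _ (hrS x hx)
          (sup_le (hπr x hx _) (hπr x hx _)), mul_inv_eq_iff_eq_mul] at h1
        rw [h1]
        group
    refine ⟨fun x => d (ι x) (π (ι x) x) * c (π (ι x) x) (r x) * (c x (r x))⁻¹,
      fun x hx y hy hxy => ?_⟩
    have hx' := hι x hx
    have hy' := hπW x hx y hy hxy _ hx'
    have hrr := hrmono x hx y hy hxy
    have h1 := hdW _ _ hx' _ hy' (hπmono x hx y hy hxy _)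
    have h2 := hc _ (hWS _ hx') _ (hWS _ hy') _ (hrS y hy) (hπmono x hx y hy hxy _) (hπr y hy _)
    have h3 := hc _ (hWS _ hx') _ (hrS x hx) _ (hrS y hy) (hπr x hx _) hrr
    have h4 := hc x hx _ (hrS x hx) _ (hrS y hy) (hr x hx) hrr
    have h5 := hc x hx y hy _ (hrS y hy) hxy (hr y hy)
    simp only [hindep y hy _ hy']
    rw [h1, ← h3] at h2
    rw [← h5] at h4
    have h6 : c (r x) (r y) = (c (π (ι x) x) (r x))⁻¹ * ((d (ι x) (π (ι x) x))⁻¹ *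
        d (ι x) (π (ι x) y) * c (π (ι x) y) (r y)) := by
      rw [h2]
      group
    rw [eq_mul_inv_of_mul_eq h4.symm, h6]
    group

end TripleJoin

section ElementaryAbelian

variable {G : Type*} [Group G] {p : ℕ}

theorem isElementaryAbelian_subgroup_iff {H : Subgroup G} :
    IsElementaryAbelian p ↥H ↔ H ≤ Subgroup.centralizer (H : Set G) ∧ ∀ a ∈ H, a ^ p = 1 := by
  constructor
  · rintro ⟨h1, h2⟩
    refine ⟨fun a ha => Subgroup.mem_centralizer_iff.2 fun b hb => ?_, fun a ha => ?_⟩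
    · exact congrArg Subtype.val (h1 ⟨b, hb⟩ ⟨a, ha⟩)
    · exact congrArg Subtype.val (h2 ⟨a, ha⟩)
  · rintro ⟨h1, h2⟩
    exact ⟨fun a b => Subtype.ext (Subgroup.mem_centralizer_iff.1 (h1 b.2) a a.2),
      fun a => Subtype.ext (h2 a a.2)⟩

theorem IsElementaryAbelian.mono {H K : Subgroup G} (hK : IsElementaryAbelian p ↥K)
    (hHK : H ≤ K) : IsElementaryAbelian p ↥H := by
  rw [isElementaryAbelian_subgroup_iff] at hK ⊢
  exact ⟨(hHK.trans hK.1).trans (Subgroup.centralizer_le hHK), fun a ha => hK.2 a (hHK ha)⟩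

theorem IsElementaryAbelian.le_centralizer {H K L : Subgroup G} (hK : IsElementaryAbelian p ↥K)
    (hHK : H ≤ K) (hLK : L ≤ K) : H ≤ Subgroup.centralizer (L : Set G) :=
  (hHK.trans (isElementaryAbelian_subgroup_iff.1 hK).1).trans (Subgroup.centralizer_le hLK)

theorem IsElementaryAbelian.pow_eq_one {K : Subgroup G} (hK : IsElementaryAbelian p ↥K) {x : G}
    (hx : x ∈ K) : x ^ p = 1 :=
  (isElementaryAbelian_subgroup_iff.1 hK).2 x hx

theorem IsElementaryAbelian.isPGroup {K : Subgroup G} (hK : IsElementaryAbelian p ↥K) :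
    IsPGroup p ↥K := fun g => ⟨1, by rw [pow_one]; exact hK.2 g⟩

theorem Subgroup.mem_sup_of_le_centralizer {A B : Subgroup G}
    (hAB : A ≤ Subgroup.centralizer (B : Set G)) {x : G} :
    x ∈ A ⊔ B ↔ ∃ a ∈ A, ∃ b ∈ B, a * b = x := by
  rw [← SetLike.mem_coe, Subgroup.coe_mul_of_left_le_normalizer_right A B
    (hAB.trans (Subgroup.centralizer_le_normalizer _)), Set.mem_mul]
  rfl

theorem Subgroup.commute_of_le_centralizer {A B : Subgroup G}
    (hAB : A ≤ Subgroup.centralizer (B : Set G)) {a b : G} (ha : a ∈ A) (hb : b ∈ B) :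
    Commute a b :=
  (Subgroup.mem_centralizer_iff.1 (hAB ha) b hb).symm

theorem Subgroup.eq_of_mul_eq_mul_of_inf_eq_bot {A B : Subgroup G} (hAB : A ⊓ B = ⊥)
    {a a' b b' : G} (ha : a ∈ A) (ha' : a' ∈ A) (hb : b ∈ B) (hb' : b' ∈ B)
    (h : a * b = a' * b') : a = a' ∧ b = b' := by
  have h1 : a'⁻¹ * a = b' * b⁻¹ := by
    rw [inv_mul_eq_iff_eq_mul, ← mul_assoc, eq_mul_inv_iff_mul_eq, h]
  have h2 : a'⁻¹ * a ∈ A ⊓ B :=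
    ⟨A.mul_mem (A.inv_mem ha') ha, h1 ▸ B.mul_mem hb' (B.inv_mem hb)⟩
  rw [hAB, Subgroup.mem_bot, inv_mul_eq_one] at h2
  subst h2
  exact ⟨rfl, mul_left_cancel h⟩

theorem IsElementaryAbelian.sup {H K : Subgroup G} (hH : IsElementaryAbelian p ↥H)
    (hK : IsElementaryAbelian p ↥K) (hHK : H ≤ Subgroup.centralizer (K : Set G)) :
    IsElementaryAbelian p ↥(H ⊔ K) := by
  have hKH := Subgroup.le_centralizer_iff.1 hHK
  rw [isElementaryAbelian_subgroup_iff] at hH hK ⊢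
  refine ⟨sup_le (Subgroup.le_centralizer_iff.1 (sup_le hH.1 hKH))
    (Subgroup.le_centralizer_iff.1 (sup_le hHK hK.1)), fun x hx => ?_⟩
  obtain ⟨a, ha, b, hb, rfl⟩ := (Subgroup.mem_sup_of_le_centralizer hHK).1 hx
  rw [(Subgroup.commute_of_le_centralizer hHK ha hb).mul_pow, hH.2 a ha, hK.2 b hb, one_mul]

theorem isElementaryAbelian_zpowers {b : G} (hb : b ^ p = 1) :
    IsElementaryAbelian p ↥(Subgroup.zpowers b) := by
  rw [isElementaryAbelian_subgroup_iff]
  refine ⟨Subgroup.zpowers_le.2 (Subgroup.mem_centralizer_iff.2 ?_), ?_⟩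
  · rintro _ ⟨k, rfl⟩
    exact (Commute.refl b).zpow_left k
  · rintro _ ⟨k, rfl⟩
    rw [← zpow_natCast, zpow_comm b k p, zpow_natCast, hb, one_zpow]

theorem zpowers_mem_apSetIn {b : G} (hb : b ^ p = 1) (hb1 : b ≠ 1) {K : Subgroup G} (hbK : b ∈ K) :
    Subgroup.zpowers b ∈ apSetIn p K :=
  ⟨fun h => hb1 (Subgroup.zpowers_eq_bot.1 h), isElementaryAbelian_zpowers hb,
    Subgroup.zpowers_le.2 hbK⟩

theorem exists_pow_eq_one_of_dvd_card [Finite G] (hp : p.Prime) (K : Subgroup G)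
    (h : p ∣ Nat.card ↥K) : ∃ b ∈ K, b ^ p = 1 ∧ b ≠ 1 := by
  have := Fact.mk hp
  obtain ⟨x, hx⟩ := exists_prime_orderOf_dvd_card' p h
  refine ⟨x, x.2, ?_, fun h1 => ?_⟩
  · have := pow_orderOf_eq_one x
    rw [hx] at this
    exact congrArg Subtype.val this
  · rw [OneMemClass.coe_eq_one.1 h1, orderOf_one] at hx
    exact hp.one_lt.ne hx

/-- The projection to `A` of a subgroup of the commuting product of `A` and `B`. -/
def subProj (A B E : Subgroup G) : Subgroup G := A ⊓ (E ⊔ B)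

theorem subProj_mono (A B : Subgroup G) {E F : Subgroup G} (h : E ≤ F) :
    subProj A B E ≤ subProj A B F :=
  inf_le_inf_left _ (sup_le_sup_right h _)

theorem mem_subProj {A B E : Subgroup G} {a b : G} (ha : a ∈ A) (hb : b ∈ B) (h : a * b ∈ E) :
    a ∈ subProj A B E := by
  refine ⟨ha, ?_⟩
  rw [← mul_inv_cancel_right a b]
  exact Subgroup.mul_mem_sup h (B.inv_mem hb)

theorem exists_mul_mem_of_mem_subProj {A B E : Subgroup G}
    (hAB : A ≤ Subgroup.centralizer (B : Set G)) (hE : E ≤ A ⊔ B) {a : G}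
    (ha : a ∈ subProj A B E) : ∃ b ∈ B, a * b ∈ E := by
  have h1 : A ⊔ B ≤ Subgroup.normalizer (B : Set G) :=
    sup_le (hAB.trans (Subgroup.centralizer_le_normalizer _)) Subgroup.le_normalizer
  have h2 : a ∈ ((E ⊔ B : Subgroup G) : Set G) := ha.2
  rw [Subgroup.coe_mul_of_left_le_normalizer_right E B (hE.trans h1),
    Set.mem_mul] at h2
  obtain ⟨e, he, b, hb, rfl⟩ := h2
  exact ⟨b⁻¹, B.inv_mem hb, by rwa [mul_inv_cancel_right]⟩

theorem IsElementaryAbelian.subProj {A B E : Subgroup G}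
    (hAB : A ≤ Subgroup.centralizer (B : Set G)) (hAB' : A ⊓ B = ⊥) (hE : E ≤ A ⊔ B)
    (h : IsElementaryAbelian p ↥E) : IsElementaryAbelian p ↥(subProj A B E) := by
  rw [isElementaryAbelian_subgroup_iff]
  have hc : ∀ a ∈ A, ∀ b ∈ B, Commute a b := fun a ha b hb =>
    Subgroup.commute_of_le_centralizer hAB ha hb
  refine ⟨fun a ha => Subgroup.mem_centralizer_iff.2 fun a' ha' => ?_, fun a ha => ?_⟩
  · obtain ⟨b, hb, hab⟩ := exists_mul_mem_of_mem_subProj hAB hE ha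
    obtain ⟨b', hb', hab'⟩ := exists_mul_mem_of_mem_subProj hAB hE ha'
    have h1 := (Subgroup.commute_of_le_centralizer (h.le_centralizer le_rfl le_rfl) hab' hab).eq
    rw [(hc a ha.1 b' hb').symm.mul_mul_mul_comm, (hc a' ha'.1 b hb).symm.mul_mul_mul_comm] at h1
    exact (Subgroup.eq_of_mul_eq_mul_of_inf_eq_bot hAB' (A.mul_mem ha'.1 ha.1)
      (A.mul_mem ha.1 ha'.1) (B.mul_mem hb' hb) (B.mul_mem hb hb') h1).1
  · obtain ⟨b, hb, hab⟩ := exists_mul_mem_of_mem_subProj hAB hE ha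
    have h1 := h.pow_eq_one hab
    rw [(hc a ha.1 b hb).mul_pow, ← mul_one (1 : G)] at h1
    exact (Subgroup.eq_of_mul_eq_mul_of_inf_eq_bot hAB' (A.pow_mem ha.1 p) A.one_mem
      (B.pow_mem hb p) B.one_mem h1).1

end ElementaryAbelian

section CommutingFamily

/-- A family of pairwise commuting subgroups whose join has trivial centralizer. -/
structure IsCentreFreeFamily {G ι : Type*} [Group G] (L : ι → Subgroup G) : Prop where
  comm : ∀ i j, i ≠ j → L i ≤ Subgroup.centralizer (L j : Set G)
  centralizer_eq_bot : Subgroup.centralizer ((⨆ i, L i : Subgroup G) : Set G) = ⊥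

variable {G ι : Type*} [Group G] {L : ι → Subgroup G} {p : ℕ}

/-- The join of the members of a family indexed by a set. -/
def joinOn (L : ι → Subgroup G) (J : Set ι) : Subgroup G := ⨆ j ∈ J, L j

theorem le_joinOn {J : Set ι} {j : ι} (hj : j ∈ J) : L j ≤ joinOn L J :=
  le_iSup₂_of_le j hj le_rfl

theorem joinOn_le {J : Set ι} {K : Subgroup G} (h : ∀ j ∈ J, L j ≤ K) : joinOn L J ≤ K :=
  iSup₂_le h

theorem joinOn_le_iSup (J : Set ι) : joinOn L J ≤ ⨆ i, L i :=
  joinOn_le fun j _ => le_iSup L j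

theorem joinOn_singleton (i : ι) : joinOn L {i} = L i := by
  simp [joinOn]

theorem joinOn_sup_compl (J : Set ι) : joinOn L J ⊔ joinOn L Jᶜ = ⨆ i, L i := by
  refine le_antisymm (sup_le (joinOn_le_iSup J) (joinOn_le_iSup Jᶜ)) (iSup_le fun i => ?_)
  by_cases hi : i ∈ J
  · exact (le_joinOn hi).trans le_sup_left
  · exact (le_joinOn (Set.mem_compl hi)).trans le_sup_right

namespace IsCentreFreeFamily

theorem joinOn_le_centralizer (hL : IsCentreFreeFamily L) {J K : Set ι} (hJK : Disjoint J K) :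
    joinOn L J ≤ Subgroup.centralizer (joinOn L K : Set G) := by
  refine joinOn_le fun j hj => Subgroup.le_centralizer_iff.1 (joinOn_le fun k hk => ?_)
  exact hL.comm k j fun h => Set.disjoint_left.1 hJK hj (h ▸ hk)

theorem eq_one_of_forall (hL : IsCentreFreeFamily L) {x : G}
    (hx : ∀ j, x ∈ Subgroup.centralizer (L j : Set G)) : x = 1 := by
  rw [← Subgroup.mem_bot, ← hL.centralizer_eq_bot, ← Subgroup.zpowers_le]
  refine Subgroup.le_centralizer_iff.1 (iSup_le fun j => Subgroup.le_centralizer_iff.1 ?_)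
  exact Subgroup.zpowers_le.2 (hx j)

theorem joinOn_inf_joinOn (hL : IsCentreFreeFamily L) {J K : Set ι} (hJK : Disjoint J K) :
    joinOn L J ⊓ joinOn L K = ⊥ := by
  refine (Subgroup.eq_bot_iff_forall _).2 fun x hx => hL.eq_one_of_forall fun j => ?_
  have key : ∀ J : Set ι, j ∉ J → x ∈ joinOn L J → x ∈ Subgroup.centralizer (L j : Set G) := by
    intro J hj hx
    rw [← joinOn_singleton (L := L) j]
    exact hL.joinOn_le_centralizer (Set.disjoint_singleton_right.2 hj) hx
  by_cases hj : j ∈ J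
  · exact key K (Set.disjoint_left.1 hJK hj) hx.2
  · exact key J hj hx.1

theorem exists_mul_eq (hL : IsCentreFreeFamily L) (J : Set ι) {x : G} (hx : x ∈ ⨆ i, L i) :
    ∃ a ∈ joinOn L J, ∃ b ∈ joinOn L Jᶜ, a * b = x := by
  rw [← joinOn_sup_compl J] at hx
  exact (Subgroup.mem_sup_of_le_centralizer
    (hL.joinOn_le_centralizer disjoint_compl_right)).1 hx

theorem eq_one_of_forall_mem (hL : IsCentreFreeFamily L) {x : G}
    (hx : ∀ j, x ∈ joinOn L {j}ᶜ) : x = 1 := by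
  refine hL.eq_one_of_forall fun j => ?_
  rw [← joinOn_singleton (L := L) j]
  exact hL.joinOn_le_centralizer disjoint_compl_left (hx j)

/-- A product of three complementary parts of the family. -/
theorem posetConn_and_posetH1Trivial {G : Type} [Group G] [Finite G] {L : ι → Subgroup G}
    (hL : IsCentreFreeFamily L) (hp : p.Prime) (hdvd : ∀ i, p ∣ Nat.card ↥(L i)) (c : ι → Fin 3)
    (hc : Surjective c) :
    PosetConn (apSetIn p (⨆ i, L i)) ∧ PosetH1Trivial (apSetIn p (⨆ i, L i)) := by
  have hdisj : ∀ i j, i ≠ j → Disjoint (c ⁻¹' {i}) (c ⁻¹' {j}) := fun i j hij =>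
    Disjoint.preimage c (Set.disjoint_singleton.2 hij)
  have hcomm : ∀ i j, i ≠ j → ∀ x ≤ joinOn L (c ⁻¹' {i}), ∀ y ≤ joinOn L (c ⁻¹' {j}),
      x ≤ Subgroup.centralizer (y : Set G) := fun i j hij x hx y hy =>
    (hx.trans (hL.joinOn_le_centralizer (hdisj i j hij))).trans (Subgroup.centralizer_le hy)
  let π : Fin 3 → Subgroup G → Subgroup G := fun i =>
    subProj (joinOn L (c ⁻¹' {i})) (joinOn L (c ⁻¹' {i})ᶜ)
  have hπM : ∀ i x, π i x ≤ joinOn L (c ⁻¹' {i}) := fun i x => inf_le_left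
  have hπE : ∀ i, ∀ x ∈ apSetIn p (⨆ i, L i), IsElementaryAbelian p ↥(π i x) := fun i x hx =>
    hx.2.1.subProj (hL.joinOn_le_centralizer disjoint_compl_right)
      (hL.joinOn_inf_joinOn disjoint_compl_right) (hx.2.2.trans (joinOn_sup_compl _).ge)
  have hle : ∀ x ∈ apSetIn p (⨆ i, L i), x ≤ π 0 x ⊔ π 1 x ⊔ π 2 x := by
    intro x hx g hg
    have hsplit : ∃ a ∈ joinOn L (c ⁻¹' {0}), ∃ b ∈ joinOn L (c ⁻¹' {1}),
        ∃ d ∈ joinOn L (c ⁻¹' {2}), a * b * d = g := by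
      obtain ⟨a, ha, b', hb', rfl⟩ := hL.exists_mul_eq (c ⁻¹' {0}) (hx.2.2 hg)
      have h1 : joinOn L (c ⁻¹' {0})ᶜ ≤ joinOn L (c ⁻¹' {1}) ⊔ joinOn L (c ⁻¹' {2}) := by
        refine joinOn_le fun j hj => ?_
        have hj0 : c j ≠ 0 := hj
        obtain h | h : c j = 1 ∨ c j = 2 := by
          revert hj0
          generalize c j = k
          revert k
          decide
        · exact (le_joinOn (show j ∈ c ⁻¹' {1} from h)).trans le_sup_left
        · exact (le_joinOn (show j ∈ c ⁻¹' {2} from h)).trans le_sup_right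
      obtain ⟨b, hb, d, hd, rfl⟩ := (Subgroup.mem_sup_of_le_centralizer
        (hL.joinOn_le_centralizer (hdisj 1 2 (by decide)))).1 (h1 hb')
      exact ⟨a, ha, b, hb, d, hd, mul_assoc a b d⟩
    obtain ⟨a, ha, b, hb, d, hd, rfl⟩ := hsplit
    have hMc : ∀ i j, i ≠ j → joinOn L (c ⁻¹' {j}) ≤ joinOn L (c ⁻¹' {i})ᶜ := by
      intro i j hij
      exact joinOn_le fun k hk => le_joinOn (Set.disjoint_right.1 (hdisj i j hij) hk)
    have hab : Commute a b := Subgroup.commute_of_le_centralizer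
      (hL.joinOn_le_centralizer (hdisj 0 1 (by decide))) ha hb
    have had : Commute a d := Subgroup.commute_of_le_centralizer
      (hL.joinOn_le_centralizer (hdisj 0 2 (by decide))) ha hd
    have hbd : Commute b d := Subgroup.commute_of_le_centralizer
      (hL.joinOn_le_centralizer (hdisj 1 2 (by decide))) hb hd
    refine Subgroup.mul_mem_sup (Subgroup.mul_mem_sup ?_ ?_) ?_
    · refine mem_subProj ha (Subgroup.mul_mem _ (hMc 0 1 (by decide) hb)
        (hMc 0 2 (by decide) hd)) ?_
      rwa [← mul_assoc]
    · refine mem_subProj hb (Subgroup.mul_mem _ (hMc 1 0 (by decide) ha)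
        (hMc 1 2 (by decide) hd)) ?_
      rwa [← mul_assoc, ← hab.eq]
    · refine mem_subProj hd (Subgroup.mul_mem _ (hMc 2 0 (by decide) ha)
        (hMc 2 1 (by decide) hb)) ?_
      rwa [← (had.mul_left hbd).eq]
  have hr : ∀ x, ∀ i, π i x ≤ π 0 x ⊔ π 1 x ⊔ π 2 x := by
    intro x i
    fin_cases i
    · exact le_sup_left.trans le_sup_left
    · exact le_sup_right.trans le_sup_left
    · exact le_sup_right
  have hM3 : ∀ i j k, i ≠ j → j ≠ k → i ≠ k → ∀ x ≤ joinOn L (c ⁻¹' {i}),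
      ∀ y ≤ joinOn L (c ⁻¹' {j}), ∀ z ≤ joinOn L (c ⁻¹' {k}), IsElementaryAbelian p ↥x →
      IsElementaryAbelian p ↥y → IsElementaryAbelian p ↥z →
      IsElementaryAbelian p ↥(x ⊔ y ⊔ z) ∧ x ⊔ y ⊔ z ≤ ⨆ i, L i := by
    intro i j k hij hjk hik x hx y hy z hz hxE hyE hzE
    refine ⟨(hxE.sup hyE (hcomm i j hij x hx y hy)).sup hzE
      (sup_le (hcomm i k hik x hx z hz) (hcomm j k hjk y hy z hz)), ?_⟩
    exact sup_le (sup_le (hx.trans (joinOn_le_iSup _)) (hy.trans (joinOn_le_iSup _)))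
      (hz.trans (joinOn_le_iSup _))
  refine posetConn_and_posetH1Trivial_of_triple (fun i => apSetIn p (joinOn L (c ⁻¹' {i})))
    (fun i => ?_) (fun i x hx => ⟨hx.1, hx.2.1, hx.2.2.trans (joinOn_le_iSup _)⟩)
    (fun i j hij x hx y hy => ⟨ne_bot_of_le_ne_bot hx.1 le_sup_left,
      hx.2.1.sup hy.2.1 (hcomm i j hij x hx.2.2 y hy.2.2), sup_le
        (hx.2.2.trans (joinOn_le_iSup _)) (hy.2.2.trans (joinOn_le_iSup _))⟩)
    (fun i j k hij hjk hik x hx y hy z hz =>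
      ⟨ne_bot_of_le_ne_bot hx.1 (le_sup_left.trans le_sup_left),
        hM3 i j k hij hjk hik x hx.2.2 y hy.2.2 z hz.2.2 hx.2.1 hy.2.1 hz.2.1⟩)
    (fun x => π 0 x ⊔ π 1 x ⊔ π 2 x) π (fun x hx => ⟨ne_bot_of_le_ne_bot hx.1 (hle x hx),
      hM3 0 1 2 (by decide) (by decide) (by decide) _ (hπM 0 x) _ (hπM 1 x) _ (hπM 2 x)
        (hπE 0 x hx) (hπE 1 x hx) (hπE 2 x hx)⟩) hle (fun x hx y hy hxy => ?_)
    (fun x _ => hr x) (fun x _ y _ hxy i => subProj_mono _ _ hxy)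
    (fun x hx y hy hxy i hi => ⟨ne_bot_of_le_ne_bot hi.1 (subProj_mono _ _ hxy), hπE i y hy,
      hπM i y⟩) (fun x hx => ?_)
  · obtain ⟨j, hj⟩ := hc i
    obtain ⟨b, hb, hbp, hb1⟩ := exists_pow_eq_one_of_dvd_card hp _ (hdvd j)
    exact ⟨_, zpowers_mem_apSetIn hbp hb1 (le_joinOn (show j ∈ c ⁻¹' {i} from hj) hb)⟩
  · exact sup_le_sup (sup_le_sup (subProj_mono _ _ hxy) (subProj_mono _ _ hxy))
      (subProj_mono _ _ hxy)
  · by_contra! h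
    have h0 : ∀ i, π i x = ⊥ := fun i => by
      by_contra h1
      exact h i ⟨h1, hπE i x hx, hπM i x⟩
    have h1 := hle x hx
    rw [h0, h0, h0, sup_bot_eq, sup_bot_eq] at h1
    exact hx.1 (le_bot_iff.1 h1)

end IsCentreFreeFamily

end CommutingFamily

section FixedPoints

variable {p : ℕ}

theorem IsPGroup.exists_pow_eq_one_of_ne_one {G : Type*} [Group G] {b : G} {n : ℕ}
    (hb : b ^ p ^ n = 1) (hb1 : b ≠ 1) : ∃ k, (b ^ k) ^ p = 1 ∧ b ^ k ≠ 1 := by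
  classical
  have h : ∃ n, b ^ p ^ n = 1 := ⟨n, hb⟩
  obtain ⟨m, hm⟩ : ∃ m, Nat.find h = m + 1 := by
    refine Nat.exists_eq_succ_of_ne_zero fun h0 => hb1 ?_
    have := Nat.find_spec h
    rwa [h0, pow_zero, pow_one] at this
  refine ⟨p ^ m, ?_, Nat.find_min h (by omega)⟩
  rw [← pow_mul, ← pow_succ, ← hm]
  exact Nat.find_spec h

/-- A `p`-group acting on a finite group of order divisible by `p` fixes an element of order
`p`. -/
theorem IsPGroup.exists_fixed_of_dvd_card {E M : Type*} [Group E] [Group M] [Finite M]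
    [MulDistribMulAction E M] (hp : p.Prime) (hE : IsPGroup p E) (hM : p ∣ Nat.card M) :
    ∃ x : M, x ^ p = 1 ∧ x ≠ 1 ∧ ∀ e : E, e • x = x := by
  have := Fact.mk hp
  obtain ⟨Q, hQ⟩ := hE.nonempty_fixed_point_of_prime_not_dvd_card (Sylow p M) fun h =>
    hp.one_lt.ne' (Nat.dvd_one.1 (((card_sylow_modEq_one p M).dvd_iff dvd_rfl).1 h))
  have hQe : ∀ (e : E), ∀ q ∈ Q, e • q ∈ Q := by
    intro e q hq
    have h1 : ((e • Q : Sylow p M) : Subgroup M) = Q := by rw [hQ e]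
    have h2 := Subgroup.smul_mem_pointwise_smul q e (Q : Subgroup M) hq
    rw [← Sylow.pointwise_smul_def, h1] at h2
    exact h2
  let _ : MulAction E Q :=
    { smul := fun e q => ⟨e • (q : M), hQe e q q.2⟩
      one_smul := fun q => Subtype.ext (one_smul E (q : M))
      mul_smul := fun a b q => Subtype.ext (mul_smul a b (q : M)) }
  have hcoe : ∀ (e : E) (q : Q), ((e • q : Q) : M) = e • (q : M) := fun _ _ => rfl
  have hdvd : p ∣ Nat.card Q := by
    rw [Sylow.card_eq_multiplicity]
    exact dvd_pow_self p (hp.factorization_pos_of_dvd Nat.card_pos.ne' hM).ne'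
  obtain ⟨b, hb, hb1⟩ := hE.exists_fixed_point_of_prime_dvd_card_of_fixed_point Q hdvd
    (a := 1) fun e => Subtype.ext (by rw [hcoe, OneMemClass.coe_one, smul_one])
  obtain ⟨n, hn⟩ := Q.isPGroup' b
  obtain ⟨k, hk, hk1⟩ := IsPGroup.exists_pow_eq_one_of_ne_one hn hb1.symm
  refine ⟨((b ^ k : Q) : M), congrArg Subtype.val hk, fun h => hk1 (Subtype.ext h), fun e => ?_⟩
  have h := congrArg Subtype.val (hb e)
  rw [hcoe] at h
  rw [SubmonoidClass.coe_pow, smul_pow', h]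

theorem exists_commute_of_le_normalizer {G : Type*} [Group G] [Finite G] (hp : p.Prime)
    {E M : Subgroup G} (hE : IsPGroup p ↥E) (hEM : E ≤ Subgroup.normalizer (M : Set G))
    (hM : p ∣ Nat.card ↥M) :
    ∃ x ∈ M, x ^ p = 1 ∧ x ≠ 1 ∧ x ∈ Subgroup.centralizer (E : Set G) := by
  let _ : MulDistribMulAction E M := MulDistribMulAction.compHom M (Subgroup.inclusion hEM)
  obtain ⟨x, hx, hx1, hxE⟩ := hE.exists_fixed_of_dvd_card hp hM
  refine ⟨x, x.2, congrArg Subtype.val hx, fun h => hx1 (Subtype.ext h),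
    Subgroup.mem_centralizer_iff.2 fun e he => ?_⟩
  have h1 : e * x * e⁻¹ = x := congrArg Subtype.val (hxE ⟨e, he⟩)
  exact mul_inv_eq_iff_eq_mul.1 h1

end FixedPoints

section SimpleFamily

variable {G : Type*} [Group G] {p : ℕ}

/-- Two simple subgroups normalizing each other are equal or commute. -/
theorem eq_or_le_centralizer_of_isSimpleGroup {H K : Subgroup G} [IsSimpleGroup ↥H]
    [IsSimpleGroup ↥K] (hHK : H ≤ Subgroup.normalizer (K : Set G))
    (hKH : K ≤ Subgroup.normalizer (H : Set G)) :
    H = K ∨ H ≤ Subgroup.centralizer (K : Set G) := by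
  have hdisj : Disjoint H K → H ≤ Subgroup.centralizer (K : Set G) := by
    intro h x hx
    refine Subgroup.mem_centralizer_iff.2 fun y hy => ?_
    have h1 : x * y * x⁻¹ * y⁻¹ ∈ H ⊓ K := by
      refine ⟨?_, K.mul_mem ((Subgroup.mem_normalizer_iff.1 (hHK hx) y).1 hy) (K.inv_mem hy)⟩
      rw [mul_assoc, mul_assoc]
      refine H.mul_mem hx ?_
      rw [← mul_assoc]
      exact (Subgroup.mem_normalizer_iff.1 (hKH hy) _).1 (H.inv_mem hx)
    rw [h.eq_bot, Subgroup.mem_bot, mul_inv_eq_one, mul_inv_eq_iff_eq_mul] at h1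
    exact h1.symm
  rcases (Subgroup.normal_subgroupOf_of_le_normalizer hHK).eq_bot_or_eq_top with h | h
  · exact .inr (hdisj (Subgroup.subgroupOf_eq_bot.1 h).symm)
  rcases (Subgroup.normal_subgroupOf_of_le_normalizer hKH).eq_bot_or_eq_top with h' | h'
  · exact .inr (hdisj (Subgroup.subgroupOf_eq_bot.1 h'))
  exact .inl (le_antisymm (Subgroup.subgroupOf_eq_top.1 h) (Subgroup.subgroupOf_eq_top.1 h'))

theorem mem_conjSub {g x : G} {H : Subgroup G} : x ∈ conjSub g H ↔ g⁻¹ * x * g ∈ H := by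
  constructor
  · rintro ⟨y, hy, rfl⟩
    simpa [mul_assoc] using hy
  · exact fun h => ⟨_, h, by simp [mul_assoc]⟩

theorem conj_mem_conjSub (g : G) {x : G} {H : Subgroup G} (hx : x ∈ H) :
    g * x * g⁻¹ ∈ conjSub g H :=
  ⟨x, hx, rfl⟩

theorem conjSub_mul (g h : G) (H : Subgroup G) : conjSub (g * h) H = conjSub g (conjSub h H) := by
  ext x
  simp only [mem_conjSub, mul_inv_rev, mul_assoc]

theorem conjSub_one (H : Subgroup G) : conjSub 1 H = H := by
  ext x
  simp [mem_conjSub]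

instance isSimpleGroup_conjSub (g : G) (H : Subgroup G) [IsSimpleGroup ↥H] :
    IsSimpleGroup ↥(conjSub g H) :=
  (H.equivMapOfInjective _ (MulAut.conj g).injective).symm.isSimpleGroup

theorem card_conjSub (g : G) (H : Subgroup G) : Nat.card ↥(conjSub g H) = Nat.card ↥H :=
  (Nat.card_congr (H.equivMapOfInjective _ (MulAut.conj g).injective).toEquiv).symm

theorem conjSub_joinOn {ι : Type*} (L : ι → Subgroup G) (g : G) (J : Set ι) :
    conjSub g (joinOn L J) = joinOn (fun i => conjSub g (L i)) J := by
  simp only [joinOn, conjSub, Subgroup.map_iSup]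

namespace IsCentreFreeFamily

variable {ι : Type*} {L : ι → Subgroup G}

theorem iSup_le_normalizer (hL : IsCentreFreeFamily L) (i : ι) :
    ⨆ j, L j ≤ Subgroup.normalizer (L i : Set G) := by
  refine iSup_le fun j => ?_
  by_cases hij : j = i
  · exact hij ▸ Subgroup.le_normalizer
  · exact (hL.comm j i hij).trans (Subgroup.centralizer_le_normalizer _)

/-- The conjugates of the members of a family of simple groups with normal join belong to the
family. -/
theorem exists_conjSub_eq (hL : IsCentreFreeFamily L) (hN : (⨆ i, L i).Normal)
    [∀ i, IsSimpleGroup ↥(L i)] (g : G) (i : ι) : ∃ j, conjSub g (L i) = L j := by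
  by_contra! h
  have hKN : conjSub g (L i) ≤ ⨆ i, L i := by
    intro x hx
    have h1 := hN.conj_mem _ (le_iSup L i (mem_conjSub.1 hx)) g
    simpa [mul_assoc] using h1
  have hNK : ⨆ i, L i ≤ Subgroup.normalizer (conjSub g (L i) : Set G) := by
    intro x hx
    refine Subgroup.mem_normalizer_iff.2 fun y => ?_
    have h1 : g⁻¹ * x * g ∈ ⨆ i, L i := by simpa using hN.conj_mem x hx g⁻¹
    rw [mem_conjSub, mem_conjSub,
      Subgroup.mem_normalizer_iff.1 (hL.iSup_le_normalizer i h1) (g⁻¹ * y * g)]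
    simp only [mul_inv_rev, inv_inv, mul_assoc, mul_inv_cancel_left]
  have h1 : conjSub g (L i) ≤ Subgroup.centralizer ((⨆ i, L i : Subgroup G) : Set G) := by
    refine Subgroup.le_centralizer_iff.1 (iSup_le fun j => Subgroup.le_centralizer_iff.1 ?_)
    exact (eq_or_le_centralizer_of_isSimpleGroup (hKN.trans (hL.iSup_le_normalizer j))
      ((le_iSup L j).trans hNK)).resolve_left (h j)
  rw [hL.centralizer_eq_bot, le_bot_iff] at h1
  exact (Subgroup.nontrivial_iff_ne_bot _).1 (inferInstance : Nontrivial ↥(conjSub g (L i))) h1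

theorem injective (hL : IsCentreFreeFamily L) (hne : ∀ i, L i ≠ ⊥) : Injective L := by
  intro i j hij
  by_contra h
  have h1 := hL.joinOn_inf_joinOn (J := {i}) (K := {j}) (Set.disjoint_singleton.2 h)
  rw [joinOn_singleton, joinOn_singleton, ← hij, inf_idem] at h1
  exact hne i h1

/-- The action by conjugation on the index set of the family. -/
theorem exists_mulAction (hL : IsCentreFreeFamily L) (hne : ∀ i, L i ≠ ⊥)
    (hconj : ∀ g i, ∃ j, conjSub g (L i) = L j) :
    ∃ _ : MulAction G ι, ∀ (g : G) (i : ι), conjSub g (L i) = L (g • i) := by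
  choose σ hσ using hconj
  exact ⟨{ smul := σ
           one_smul := fun i => hL.injective hne ((hσ 1 i).symm.trans (conjSub_one _))
           mul_smul := fun g h i => hL.injective hne (by
            change L (σ (g * h) i) = L (σ g (σ h i))
            rw [← hσ, ← hσ, ← hσ, conjSub_mul]) }, hσ⟩

theorem conj_mem_joinOn [MulAction G ι] (hact : ∀ (g : G) (i : ι), conjSub g (L i) = L (g • i))
    {g : G} {J K : Set ι} (hJK : ∀ j ∈ J, g • j ∈ K) {x : G} (hx : x ∈ joinOn L J) :
    g * x * g⁻¹ ∈ joinOn L K := by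
  have h1 := conj_mem_conjSub g hx
  rw [conjSub_joinOn] at h1
  refine (joinOn_le (L := fun i => conjSub g (L i)) fun j hj => ?_ : _ ≤ joinOn L K) h1
  rw [hact]
  exact le_joinOn (hJK j hj)

/-- If a permutable family generates no nontrivial normal subgroup of order prime to `p`, then
`p` divides the order of each member. -/
theorem dvd_card [Finite G] [MulAction G ι] (hL : IsCentreFreeFamily L) (hp : p.Prime)
    (hact : ∀ (g : G) (i : ι), conjSub g (L i) = L (g • i)) (hne : ∀ i, L i ≠ ⊥)
    (hOp' : ∀ P : Subgroup G, P.Normal → ¬ p ∣ Nat.card ↥P → P = ⊥) (i : ι) :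
    p ∣ Nat.card ↥(L i) := by
  by_contra hi
  let J : Set ι := {j | ¬ p ∣ Nat.card ↥(L j)}
  have hnormal : (joinOn L J).Normal := ⟨fun x hx g => conj_mem_joinOn hact
    (fun j hj => by
      change ¬ p ∣ Nat.card ↥(L (g • j))
      rwa [← hact, card_conjSub]) hx⟩
  refine hne i (le_bot_iff.1 ((le_joinOn (show i ∈ J from hi)).trans
    (hOp' _ hnormal fun hdvd => ?_).le))
  obtain ⟨x, hx, hxp, hx1⟩ := exists_pow_eq_one_of_dvd_card hp _ hdvd
  refine hx1 (hL.eq_one_of_forall_mem fun j => ?_)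
  by_cases hj : j ∈ J
  · obtain ⟨a, ha, b, hb, rfl⟩ := hL.exists_mul_eq {j} (joinOn_le_iSup J hx)
    have hab := Subgroup.commute_of_le_centralizer
      (hL.joinOn_le_centralizer disjoint_compl_right) ha hb
    rw [hab.mul_pow, ← mul_one (1 : G)] at hxp
    have hap := (Subgroup.eq_of_mul_eq_mul_of_inf_eq_bot
      (hL.joinOn_inf_joinOn disjoint_compl_right) (Subgroup.pow_mem _ ha p) (Subgroup.one_mem _)
      (Subgroup.pow_mem _ hb p) (Subgroup.one_mem _) hxp).1
    rw [joinOn_singleton] at ha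
    have ha1 : a = 1 := by
      by_contra ha1
      have := Fact.mk hp
      have h1 := (L j).orderOf_dvd_natCard ha
      rw [orderOf_eq_prime hap ha1] at h1
      exact hj h1
    rwa [ha1, one_mul]
  · exact joinOn_le (fun k hk =>
      le_joinOn (show k ∈ ({j}ᶜ : Set ι) from fun h : k = j => hj (h ▸ hk))) hx

end IsCentreFreeFamily

end SimpleFamily

section Over

variable {G : Type} [Group G] {p : ℕ}

/-- The elementary abelian `p`-subgroups which meet `N` nontrivially. -/
def apSetMeeting (p : ℕ) {G : Type*} [Group G] (N : Subgroup G) : Set (Subgroup G) :=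
  {F | F ∈ apSet p G ∧ F ⊓ N ≠ ⊥}

/-- The elementary abelian `p`-subgroups which contain `E` and meet `N` nontrivially. -/
def apSetOver (p : ℕ) {G : Type*} [Group G] (N E : Subgroup G) : Set (Subgroup G) :=
  {F | F ∈ apSetMeeting p N ∧ E ≤ F}

/-- The elements of order `p` of `N` centralizing `E`. -/
def fixedElements (p : ℕ) {G : Type*} [Group G] (N E : Subgroup G) : Set G :=
  {c | c ∈ N ∧ c ∈ Subgroup.centralizer (E : Set G) ∧ c ^ p = 1 ∧ c ≠ 1}

variable {N E : Subgroup G}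

theorem sup_zpowers_mem_apSetOver (hE : IsElementaryAbelian p ↥E) {c : G}
    (hc : c ∈ fixedElements p N E) : E ⊔ Subgroup.zpowers c ∈ apSetOver p N E := by
  obtain ⟨hcN, hcE, hcp, hc1⟩ := hc
  have h1 : Subgroup.zpowers c ≠ ⊥ := fun h => hc1 (Subgroup.zpowers_eq_bot.1 h)
  exact ⟨⟨⟨ne_bot_of_le_ne_bot h1 le_sup_right, hE.sup (isElementaryAbelian_zpowers hcp)
    (Subgroup.le_centralizer_iff.1 (Subgroup.zpowers_le.2 hcE))⟩,
    ne_bot_of_le_ne_bot h1 (le_inf le_sup_right (Subgroup.zpowers_le.2 hcN))⟩, le_sup_left⟩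

theorem exists_fixedElements_of_mem_apSetOver {F : Subgroup G}
    (hF : F ∈ apSetOver p N E) : ∃ c ∈ fixedElements p N E, E ⊔ Subgroup.zpowers c ≤ F := by
  obtain ⟨⟨⟨-, hFE⟩, hFN⟩, hEF⟩ := hF
  obtain ⟨c, hc, hc1⟩ := (Subgroup.bot_or_exists_ne_one _).resolve_left hFN
  exact ⟨c, ⟨hc.2, hFE.le_centralizer le_rfl hEF hc.1, hFE.pow_eq_one hc.1, hc1⟩,
    sup_le hEF (Subgroup.zpowers_le.2 hc.1)⟩

/-- The poset of overgroups of `E` meeting `N` is connected as soon as the commuting graph of the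
elements of order `p` in `C_N(E)` is connected. -/
theorem posetConn_apSetOver (hE : IsElementaryAbelian p ↥E)
    (hne : (fixedElements p N E).Nonempty)
    (h : ∀ Q : G → Prop, (∀ c ∈ fixedElements p N E, ∀ d ∈ fixedElements p N E, Commute c d →
      Q c → Q d) → ∀ c ∈ fixedElements p N E, ∀ d ∈ fixedElements p N E, Q c → Q d) :
    PosetConn (apSetOver p N E) := by
  refine ⟨let ⟨c, hc⟩ := hne; ⟨_, sup_zpowers_mem_apSetOver hE hc⟩, fun P hP F hF F' hF' hPF => ?_⟩
  obtain ⟨c, hc, hcF⟩ := exists_fixedElements_of_mem_apSetOver hF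
  obtain ⟨d, hd, hdF⟩ := exists_fixedElements_of_mem_apSetOver hF'
  have hmem := fun {c : G} (hc : c ∈ fixedElements p N E) =>
    sup_zpowers_mem_apSetOver hE hc
  refine (hP _ (hmem hd) _ hF' hdF).1 (h (fun c => P (E ⊔ Subgroup.zpowers c)) ?_ c hc d hd
    ((hP _ (hmem hc) _ hF hcF).2 hPF))
  intro c hc d hd hcd hPc
  have h1 : E ⊔ Subgroup.zpowers c ⊔ Subgroup.zpowers d ∈ apSetOver p N E := by
    obtain ⟨⟨h1, h2⟩, h3⟩ := hmem hc
    refine ⟨⟨⟨ne_bot_of_le_ne_bot h1.1 le_sup_left, h1.2.sup (isElementaryAbelian_zpowers hd.2.2.1)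
      (Subgroup.le_centralizer_iff.1 (Subgroup.zpowers_le.2 ?_))⟩,
      ne_bot_of_le_ne_bot h2 (inf_le_inf_right _ le_sup_left)⟩, h3.trans le_sup_left⟩
    refine Subgroup.zpowers_le.1 (Subgroup.le_centralizer_iff.1 (sup_le
      (Subgroup.le_centralizer_iff.1 (Subgroup.zpowers_le.2 hd.2.1)) (Subgroup.zpowers_le.2 ?_)))
    refine Subgroup.mem_centralizer_iff.2 ?_
    rintro _ ⟨k, rfl⟩
    exact (hcd.symm.zpow_left k).eq
  exact (hP _ (hmem hd) _ h1 (sup_le_sup_right le_sup_left _)).2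
    ((hP _ (hmem hc) _ h1 le_sup_left).1 hPc)

end Over

section OverInvariant

variable {G : Type} [Group G] {p : ℕ} {ι : Type*} [MulAction G ι] {L : ι → Subgroup G}

theorem le_normalizer_joinOn (hact : ∀ (g : G) (i : ι), conjSub g (L i) = L (g • i))
    {E : Subgroup G} {J : Set ι} (hJ : ∀ e ∈ E, ∀ j ∈ J, e • j ∈ J) :
    E ≤ Subgroup.normalizer (joinOn L J : Set G) := by
  intro e he
  refine Subgroup.mem_normalizer_iff.2 fun x =>
    ⟨IsCentreFreeFamily.conj_mem_joinOn hact (hJ e he), fun h => ?_⟩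
  have h1 := IsCentreFreeFamily.conj_mem_joinOn hact (hJ e⁻¹ (E.inv_mem he)) h
  simpa [mul_assoc] using h1

theorem exists_mem_joinOn_fixedElements [Finite G] (hp : p.Prime)
    (hact : ∀ (g : G) (i : ι), conjSub g (L i) = L (g • i))
    (hdvd : ∀ i, p ∣ Nat.card ↥(L i)) {E : Subgroup G} (hE : IsPGroup p ↥E)
    {J : Set ι} (hJne : J.Nonempty) (hJ : ∀ e ∈ E, ∀ j ∈ J, e • j ∈ J) :
    ∃ x ∈ joinOn L J, x ∈ fixedElements p (⨆ i, L i) E := by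
  obtain ⟨j, hj⟩ := hJne
  obtain ⟨x, hx, hxp, hx1, hxE⟩ := exists_commute_of_le_normalizer hp hE
    (le_normalizer_joinOn hact hJ) ((hdvd j).trans (Subgroup.card_dvd_of_le (le_joinOn hj)))
  exact ⟨x, hx, joinOn_le_iSup J hx, hxE, hxp, hx1⟩

theorem exists_mem_apSetOver [Finite G] (hp : p.Prime) [Nonempty ι]
    (hact : ∀ (g : G) (i : ι), conjSub g (L i) = L (g • i))
    (hdvd : ∀ i, p ∣ Nat.card ↥(L i)) {E : Subgroup G} (hE : IsElementaryAbelian p ↥E) :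
    (apSetOver p (⨆ i, L i) E).Nonempty := by
  obtain ⟨x, -, hx⟩ := exists_mem_joinOn_fixedElements hp hact hdvd hE.isPGroup
    Set.univ_nonempty fun _ _ _ _ => Set.mem_univ _
  exact ⟨_, sup_zpowers_mem_apSetOver hE hx⟩

/-- The components of a fixed element with respect to an invariant part of the family are
fixed. -/
theorem IsCentreFreeFamily.exists_mul_eq_fixed (hL : IsCentreFreeFamily L)
    (hact : ∀ (g : G) (i : ι), conjSub g (L i) = L (g • i)) {E : Subgroup G}
    {J : Set ι} (hJ : ∀ e ∈ E, ∀ j ∈ J, e • j ∈ J) (hJ' : ∀ e ∈ E, ∀ j ∈ Jᶜ, e • j ∈ Jᶜ)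
    {c : G} (hc : c ∈ fixedElements p (⨆ i, L i) E) :
    ∃ a ∈ joinOn L J, ∃ b ∈ joinOn L Jᶜ, a * b = c ∧
      (a ≠ 1 → a ∈ fixedElements p (⨆ i, L i) E) ∧
      (b ≠ 1 → b ∈ fixedElements p (⨆ i, L i) E) := by
  obtain ⟨hcN, hcE, hcp, hc1⟩ := hc
  obtain ⟨a, ha, b, hb, rfl⟩ := hL.exists_mul_eq J hcN
  have hinf := hL.joinOn_inf_joinOn (disjoint_compl_right (a := J))
  have hab := Subgroup.commute_of_le_centralizer
    (hL.joinOn_le_centralizer (disjoint_compl_right (a := J))) ha hb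
  rw [hab.mul_pow, ← mul_one (1 : G)] at hcp
  have h1 := Subgroup.eq_of_mul_eq_mul_of_inf_eq_bot hinf (Subgroup.pow_mem _ ha p)
    (Subgroup.one_mem _) (Subgroup.pow_mem _ hb p) (Subgroup.one_mem _) hcp
  have h2 : ∀ e ∈ E, e * a * e⁻¹ = a ∧ e * b * e⁻¹ = b := fun e he =>
    Subgroup.eq_of_mul_eq_mul_of_inf_eq_bot hinf (conj_mem_joinOn hact (hJ e he) ha) ha
      (conj_mem_joinOn hact (hJ' e he) hb) hb (by
        have h3 := Subgroup.mem_centralizer_iff.1 hcE e he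
        rw [← mul_inv_eq_iff_eq_mul] at h3
        rw [← h3]
        group)
  refine ⟨a, ha, b, hb, rfl, fun ha1 => ⟨joinOn_le_iSup _ ha, ?_, h1.1, ha1⟩,
    fun hb1 => ⟨joinOn_le_iSup _ hb, ?_, h1.2, hb1⟩⟩
  · exact Subgroup.mem_centralizer_iff.2 fun e he => mul_inv_eq_iff_eq_mul.1 (h2 e he).1
  · exact Subgroup.mem_centralizer_iff.2 fun e he => mul_inv_eq_iff_eq_mul.1 (h2 e he).2

/-- If `E` acts intransitively on the family, its overgroups meeting the join form a connected
poset. -/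
theorem IsCentreFreeFamily.posetConn_apSetOver_of_invariant [Finite G] (hL : IsCentreFreeFamily L)
    (hp : p.Prime) (hact : ∀ (g : G) (i : ι), conjSub g (L i) = L (g • i))
    (hdvd : ∀ i, p ∣ Nat.card ↥(L i)) {E : Subgroup G} (hE : IsElementaryAbelian p ↥E)
    {J : Set ι} (hJ : ∀ e ∈ E, ∀ j ∈ J, e • j ∈ J) (hJne : J.Nonempty) (hJne' : Jᶜ.Nonempty) :
    PosetConn (apSetOver p (⨆ i, L i) E) := by
  have hJ' : ∀ e ∈ E, ∀ j ∈ Jᶜ, e • j ∈ Jᶜ := fun e he j hj h => hj (by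
    have h1 := hJ e⁻¹ (E.inv_mem he) _ h
    rwa [inv_smul_smul] at h1)
  obtain ⟨x, hxJ, hx⟩ := exists_mem_joinOn_fixedElements hp hact hdvd hE.isPGroup hJne hJ
  obtain ⟨y, hyJ, hy⟩ := exists_mem_joinOn_fixedElements hp hact hdvd hE.isPGroup hJne' hJ'
  have hcomm : ∀ a ∈ joinOn L J, ∀ b ∈ joinOn L Jᶜ, Commute a b := fun a ha b hb =>
    Subgroup.commute_of_le_centralizer (hL.joinOn_le_centralizer disjoint_compl_right) ha hb
  refine posetConn_apSetOver hE ⟨x, hx⟩ fun Q hQ => ?_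
  have key : ∀ c ∈ fixedElements p (⨆ i, L i) E, Q c ↔ Q x := by
    have hQ' : ∀ c ∈ fixedElements p (⨆ i, L i) E, ∀ d ∈ fixedElements p (⨆ i, L i) E,
        Commute c d → (Q c ↔ Q d) := fun c hc d hd h => ⟨hQ c hc d hd h, hQ d hd c hc h.symm⟩
    intro c hc
    obtain ⟨a, ha, b, hb, rfl, ha', hb'⟩ := hL.exists_mul_eq_fixed hact hJ hJ' hc
    have hab := hcomm a ha b hb
    by_cases ha1 : a = 1
    · by_cases hb1 : b = 1
      · exact absurd (by rw [ha1, hb1, one_mul]) hc.2.2.2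
      · rw [hQ' _ hc _ (hb' hb1) (hab.mul_left (Commute.refl b)),
          hQ' _ (hb' hb1) _ hx (hcomm x hxJ b hb).symm]
    · rw [hQ' _ hc _ (ha' ha1) ((Commute.refl a).mul_left hab.symm),
        hQ' _ (ha' ha1) _ hy (hcomm a ha y hyJ), hQ' _ hy _ hx (hcomm x hxJ y hyJ).symm]
  exact fun c hc d hd h => (key d hd).2 ((key c hc).1 h)

end OverInvariant

section OverRegular

variable {G : Type} [Group G] {p : ℕ} {ι : Type*} [MulAction G ι] {L : ι → Subgroup G}

/-- The diagonal element over an element of one member of a family permuted regularly by a group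
of order `p`. -/
theorem IsCentreFreeFamily.exists_diagonal (hL : IsCentreFreeFamily L) (hp : p.Prime)
    (hact : ∀ (g : G) (i : ι), conjSub g (L i) = L (g • i)) {e : G} (he : orderOf e = p) {i : ι}
    (hfree : ∀ k, 0 < k → k < p → e ^ k • i ≠ i) {m : G} (hm : m ∈ L i) :
    ∃ b ∈ joinOn L {i}ᶜ, m * b ∈ Subgroup.centralizer (Subgroup.zpowers e : Set G) := by
  let f : ℕ → G := fun k => e ^ k * m * (e ^ k)⁻¹
  obtain ⟨q, rfl⟩ := Nat.exists_eq_succ_of_ne_zero hp.ne_zero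
  have hf0 : f 0 = m := by simp [f]
  have hfq : f (q + 1) = m := by
    have h1 : e ^ (q + 1) = 1 := by rw [← Nat.succ_eq_add_one, ← he, pow_orderOf_eq_one]
    simp [f, h1]
  have hfs : ∀ k, MulAut.conj e (f k) = f (k + 1) := by
    intro k
    simp only [f, MulAut.conj_apply, pow_succ', mul_inv_rev, mul_assoc]
  let b := ((List.range q).map fun k => f (k + 1)).prod
  have hb : b ∈ joinOn L {i}ᶜ := by
    refine Subgroup.list_prod_mem _ fun x hx => ?_
    obtain ⟨k, hk, rfl⟩ := List.mem_map.1 hx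
    rw [List.mem_range] at hk
    refine (le_joinOn (j := e ^ (k + 1) • i) (hfree (k + 1) k.succ_pos (Nat.succ_lt_succ hk))) ?_
    rw [← hact]
    exact conj_mem_conjSub _ hm
  have hmb : Commute m b := Subgroup.commute_of_le_centralizer
    (hL.joinOn_le_centralizer disjoint_compl_right) (le_joinOn (Set.mem_singleton i) hm) hb
  have hprod : ((List.range (q + 1)).map f).prod = m * b := by
    rw [List.prod_range_succ', hf0]
  have hconj : e * (m * b) * e⁻¹ = m * b := by
    rw [← MulAut.conj_apply, ← hprod, map_list_prod, List.map_map]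
    have h1 : (MulAut.conj e : G → G) ∘ f = fun k => f (k + 1) := funext hfs
    rw [h1, List.prod_range_succ, hfq, hprod, hmb.eq]
  refine ⟨b, hb, Subgroup.mem_centralizer_iff.2 ?_⟩
  rintro _ ⟨k, rfl⟩
  exact (show Commute e (m * b) from mul_inv_eq_iff_eq_mul.1 hconj).zpow_left k

/-- An element of the complement of one member which is centralized by a transitive group is
trivial. -/
theorem IsCentreFreeFamily.eq_one_of_mem_compl (hL : IsCentreFreeFamily L)
    (hact : ∀ (g : G) (i : ι), conjSub g (L i) = L (g • i)) {E : Subgroup G} {i : ι}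
    (htrans : ∀ j, ∃ e ∈ E, e • i = j) {x : G} (hx : x ∈ joinOn L {i}ᶜ)
    (hxE : x ∈ Subgroup.centralizer (E : Set G)) : x = 1 := by
  refine hL.eq_one_of_forall_mem fun j => ?_
  obtain ⟨e, he, rfl⟩ := htrans j
  have h1 : e * x * e⁻¹ = x := mul_inv_eq_iff_eq_mul.2 (Subgroup.mem_centralizer_iff.1 hxE e he)
  rw [← h1]
  exact conj_mem_joinOn hact (J := {i}ᶜ) (K := {e • i}ᶜ) (g := e)
    (fun j (hj : j ≠ i) (h : e • j = e • i) => hj (smul_left_cancel e h)) hx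

/-- If a group `E` of order `p` permutes the family regularly and the poset `A_p(L i)` is
connected, then the overgroups of `E` meeting the join form a connected poset. -/
theorem IsCentreFreeFamily.posetConn_apSetOver_of_regular (hL : IsCentreFreeFamily L)
    (hp : p.Prime) (hact : ∀ (g : G) (i : ι), conjSub g (L i) = L (g • i)) {e : G}
    (he : orderOf e = p) {i : ι} (hfree : ∀ k, 0 < k → k < p → e ^ k • i ≠ i)
    (htrans : ∀ j, ∃ g ∈ Subgroup.zpowers e, g • i = j) (hconn : PosetConn (apSetIn p (L i))) :
    PosetConn (apSetOver p (⨆ i, L i) (Subgroup.zpowers e)) := by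
  have hepow : e ^ p = 1 := he ▸ pow_orderOf_eq_one e
  have hcomm : ∀ a ∈ L i, ∀ b ∈ joinOn L {i}ᶜ, Commute a b := fun a ha b hb =>
    Subgroup.commute_of_le_centralizer (hL.joinOn_le_centralizer disjoint_compl_right)
      (le_joinOn (Set.mem_singleton i) ha) hb
  have hone := fun {x : G} => hL.eq_one_of_mem_compl (x := x) hact htrans
  have hdiag : ∀ m ∈ L i, m ^ p = 1 → m ≠ 1 → ∃ b ∈ joinOn L {i}ᶜ,
      m * b ∈ fixedElements p (⨆ i, L i) (Subgroup.zpowers e) := by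
    intro m hm hmp hm1
    obtain ⟨b, hb, hmb⟩ := hL.exists_diagonal hp hact he hfree hm
    have h1 : (m * b) ^ p = b ^ p := by rw [(hcomm m hm b hb).mul_pow, hmp, one_mul]
    refine ⟨b, hb, Subgroup.mul_mem _ (le_iSup L i hm) (joinOn_le_iSup _ hb), hmb, ?_, fun h => ?_⟩
    · exact hone (h1.symm ▸ Subgroup.pow_mem _ hb p : (m * b) ^ p ∈ joinOn L {i}ᶜ)
        (Subgroup.pow_mem _ hmb p)
    · have h2 := Subgroup.eq_of_mul_eq_mul_of_inf_eq_bot (A := joinOn L {i}) (a' := 1) (b' := 1)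
        (hL.joinOn_inf_joinOn (disjoint_compl_right (a := {i})))
        (le_joinOn (Set.mem_singleton i) hm) (Subgroup.one_mem _) hb (Subgroup.one_mem _)
        (by rw [h, mul_one])
      exact hm1 h2.1
  have hfixed : ∀ m ∈ L i, ∀ b ∈ joinOn L {i}ᶜ, ∀ m' ∈ L i, ∀ b' ∈ joinOn L {i}ᶜ,
      m * b ∈ fixedElements p (⨆ i, L i) (Subgroup.zpowers e) →
      m' * b' ∈ fixedElements p (⨆ i, L i) (Subgroup.zpowers e) →
      Commute m m' → Commute (m * b) (m' * b') := by
    intro m hm b hb m' hm' b' hb' h h' hmm'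
    have h1 : m * b * (m' * b') = m * m' * (b * b') :=
      (hcomm m' hm' b hb).symm.mul_mul_mul_comm m b'
    have h2 : m' * b' * (m * b) = m * m' * (b' * b) := by
      rw [(hcomm m hm b' hb').symm.mul_mul_mul_comm m' b, hmm'.eq]
    have h3 : (m' * b' * (m * b))⁻¹ * (m * b * (m' * b')) = (b' * b)⁻¹ * (b * b') := by
      rw [h1, h2]
      group
    have h3' : (b' * b)⁻¹ * (b * b') ∈ joinOn L {i}ᶜ := Subgroup.mul_mem _
      (Subgroup.inv_mem _ (Subgroup.mul_mem _ hb' hb)) (Subgroup.mul_mem _ hb hb')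
    have h4 := hone (h3 ▸ h3') (Subgroup.mul_mem _ (Subgroup.inv_mem _
        (Subgroup.mul_mem _ h'.2.1 h.2.1)) (Subgroup.mul_mem _ h.2.1 h'.2.1))
    exact (inv_mul_eq_one.1 h4).symm
  have hsplit : ∀ c ∈ fixedElements p (⨆ i, L i) (Subgroup.zpowers e),
      ∃ m ∈ L i, ∃ b ∈ joinOn L {i}ᶜ, m * b = c ∧ m ^ p = 1 ∧ m ≠ 1 := by
    rintro c ⟨hcN, hcE, hcp, hc1⟩
    obtain ⟨m, hm, b, hb, rfl⟩ := hL.exists_mul_eq {i} hcN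
    have hinf := hL.joinOn_inf_joinOn (disjoint_compl_right (a := {i}))
    have hm' := hm
    rw [joinOn_singleton] at hm
    rw [(hcomm m hm b hb).mul_pow, ← mul_one (1 : G)] at hcp
    refine ⟨m, hm, b, hb, rfl, (Subgroup.eq_of_mul_eq_mul_of_inf_eq_bot hinf
      (Subgroup.pow_mem _ hm' p) (Subgroup.one_mem _) (Subgroup.pow_mem _ hb p)
      (Subgroup.one_mem _) hcp).1, fun h => ?_⟩
    rw [h, one_mul] at hc1 hcE
    exact hc1 (hone hb hcE)
  refine posetConn_apSetOver (isElementaryAbelian_zpowers hepow) ?_ fun Q hQ => ?_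
  · obtain ⟨A, hA⟩ := hconn.1
    obtain ⟨m, hm, hm1⟩ := (Subgroup.bot_or_exists_ne_one _).resolve_left hA.1
    obtain ⟨b, -, hmb⟩ := hdiag m (hA.2.2 hm) (hA.2.1.pow_eq_one hm) hm1
    exact ⟨_, hmb⟩
  · let P : Subgroup G → Prop := fun A => ∃ m ∈ A, m ∈ L i ∧ ∃ b ∈ joinOn L {i}ᶜ,
      m * b ∈ fixedElements p (⨆ i, L i) (Subgroup.zpowers e) ∧ Q (m * b)
    have hP : ∀ x ∈ apSetIn p (L i), ∀ y ∈ apSetIn p (L i), x ≤ y → (P x ↔ P y) := by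
      intro x hx y hy hxy
      refine ⟨fun ⟨m, hm, h⟩ => ⟨m, hxy hm, h⟩, fun ⟨m, hm, hmL, b, hb, hmb, h⟩ => ?_⟩
      obtain ⟨m', hm', hm1⟩ := (Subgroup.bot_or_exists_ne_one _).resolve_left hx.1
      obtain ⟨b', hb', hmb'⟩ := hdiag m' (hx.2.2 hm') (hx.2.1.pow_eq_one hm') hm1
      refine ⟨m', hm', hx.2.2 hm', b', hb', hmb', hQ _ hmb _ hmb' ?_ h⟩
      exact hfixed m hmL b hb m' (hx.2.2 hm') b' hb' hmb hmb'
        (Subgroup.commute_of_le_centralizer (hy.2.1.le_centralizer le_rfl le_rfl) hm (hxy hm'))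
    intro c hc d hd hQc
    obtain ⟨m, hm, b, hb, rfl, hmp, hm1⟩ := hsplit c hc
    obtain ⟨m', hm', b', hb', rfl, hmp', hm1'⟩ := hsplit d hd
    obtain ⟨m'', hm'', hmL, b'', hb'', hmb, h⟩ := hconn.2 P hP _ (zpowers_mem_apSetIn hmp hm1 hm) _
      (zpowers_mem_apSetIn hmp' hm1' hm') ⟨m, Subgroup.mem_zpowers m, hm, b, hb, hc, hQc⟩
    refine hQ _ hmb _ hd (hfixed _ hmL _ hb'' _ hm' _ hb' hmb hd ?_) h
    obtain ⟨k, rfl⟩ := hm''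
    exact (Commute.refl m').zpow_left k

end OverRegular

section Skeleton

variable {G : Type} [Group G] {p : ℕ} {N : Subgroup G}

/-- The subgroups of order `p` which do not meet `N` and whose overgroups meeting `N` do not form
a connected poset. -/
def apSetBad (p : ℕ) {G : Type} [Group G] (N : Subgroup G) : Set (Subgroup G) :=
  {E | E ∈ apSet p G ∧ Nat.card ↥E = p ∧ E ⊓ N = ⊥ ∧ ¬ PosetConn (apSetOver p N E)}

theorem inf_mem_apSetIn {F : Subgroup G} (hF : F ∈ apSetMeeting p N) : F ⊓ N ∈ apSetIn p N :=
  ⟨hF.2, hF.1.2.mono inf_le_left, inf_le_right⟩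

theorem apSetIn_subset_apSetMeeting : apSetIn p N ⊆ apSetMeeting p N := fun E hE =>
  ⟨⟨hE.1, hE.2.1⟩, by rw [inf_eq_left.2 hE.2.2]; exact hE.1⟩

theorem posetConn_apSetMeeting (h : PosetConn (apSetIn p N)) : PosetConn (apSetMeeting p N) :=
  h.of_retract apSetIn_subset_apSetMeeting (· ⊓ N) (fun _ hF => inf_mem_apSetIn hF)
    fun _ _ => inf_le_left

theorem posetH1Trivial_apSetMeeting (h : PosetH1Trivial (apSetIn p N)) :
    PosetH1Trivial (apSetMeeting p N) :=
  h.of_retract apSetIn_subset_apSetMeeting (· ⊓ N) (fun _ hF => inf_mem_apSetIn hF)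
    (fun _ _ => inf_le_left) fun _ _ _ _ h => inf_le_inf_right N h

theorem eq_of_le_of_card_eq_prime [Finite G] (hp : p.Prime) {E F : Subgroup G}
    (hE : Nat.card ↥E = p) (hF : F ≠ ⊥) (hFE : F ≤ E) : F = E := by
  refine Subgroup.eq_of_le_of_card_ge hFE ?_
  have h1 := Subgroup.card_dvd_of_le hFE
  rw [hE] at h1
  rcases (Nat.dvd_prime hp).1 h1 with h | h
  · exact absurd (Subgroup.eq_bot_of_card_eq F h) hF
  · rw [h, hE]

theorem posetH1Trivial_apSet_diff_apSetBad [Finite G] (hp : p.Prime)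
    (hN : PosetH1Trivial (apSetMeeting p N))
    (hup : ∀ E ∈ apSet p G, (apSetOver p N E).Nonempty)
    (hgood : ∀ E ∈ apSet p G, E ⊓ N = ⊥ → Nat.card ↥E ≠ p →
      ∃ F ∈ apSet p G, F ≤ E ∧ Nat.card ↥F = p ∧ F ∉ apSetBad p N) :
    PosetH1Trivial (apSet p G \ apSetBad p N) := by
  let S : ℕ → Set (Subgroup G) := fun n =>
    apSetMeeting p N ∪ {E | E ∈ apSet p G \ apSetBad p N ∧ Nat.card ↥E ≤ n}
  have hS : ∀ n, PosetH1Trivial (S n) := by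
    intro n
    induction n with
    | zero =>
      have h0 : S 0 = apSetMeeting p N := by
        refine Set.union_eq_left.2 fun E hE => ?_
        exact absurd hE.2 (not_le.2 Nat.card_pos)
      rwa [h0]
    | succ n ih =>
      have hdiff : ∀ a ∈ S (n + 1) \ S n, a ∈ apSet p G ∧ a ∉ apSetBad p N ∧
          Nat.card ↥a = n + 1 ∧ a ⊓ N = ⊥ := by
        rintro a ⟨h1, h2⟩
        obtain ⟨h3, h4⟩ := h1.resolve_left fun h => h2 (.inl h)
        refine ⟨h3.1, h3.2, le_antisymm h4 ?_, ?_⟩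
        · by_contra h
          exact h2 (.inr ⟨h3, by omega⟩)
        · by_contra h
          exact h2 (.inl ⟨h3.1, h⟩)
      refine ih.of_links ?_ ?_ ?_
      · exact Set.union_subset_union_right _ fun E hE => ⟨hE.1, hE.2.trans n.le_succ⟩
      · intro a ha b hb hab
        exact Subgroup.eq_of_le_of_card_ge hab (by rw [(hdiff a ha).2.2.1, (hdiff b hb).2.2.1])
      · intro a ha
        obtain ⟨haA, haB, han, haN⟩ := hdiff a ha
        have hupper : ∀ t ∈ S n, a ≤ t → t ∈ apSetOver p N a := by
          rintro t (ht | ⟨-, ht⟩) hat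
          · exact ⟨ht, hat⟩
          · have h1 := Subgroup.card_le_of_le hat
            omega
        by_cases hcard : Nat.card ↥a = p
        · have hlink : {t | t ∈ S n ∧ (t ≤ a ∨ a ≤ t)} = apSetOver p N a := by
            ext t
            refine ⟨fun ⟨h1, h2⟩ => hupper t h1 (h2.elim (fun h3 => ?_) id), fun h =>
              ⟨.inl h.1, .inr h.2⟩⟩
            refine (eq_of_le_of_card_eq_prime hp hcard ?_ h3).ge
            exact h1.elim (fun h => h.1.1) fun h => h.1.1.1
          rw [hlink]
          by_contra h
          exact haB ⟨haA, hcard, haN, h⟩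
        · obtain ⟨t, htA, hta, htp, htB⟩ := hgood a haA haN hcard
          have htS : t ∈ S n := by
            refine .inr ⟨⟨htA, htB⟩, ?_⟩
            by_contra h
            have h1 := Subgroup.eq_of_le_of_card_ge hta (by omega)
            exact hcard (h1 ▸ htp)
          obtain ⟨u, hu⟩ := hup a haA
          have hupos : PosetConn {u | u = t ∨ u ∈ apSetOver p N a} := by
            refine ⟨⟨t, .inl rfl⟩, fun P hP => ?_⟩
            have h1 : ∀ x ∈ {u | u = t ∨ u ∈ apSetOver p N a}, (P t ↔ P x) := by
              rintro x (rfl | hx)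
              · exact Iff.rfl
              · exact hP t (.inl rfl) x (.inr hx) (hta.trans hx.2)
            exact fun x hx y hy h => (h1 y hy).1 ((h1 x hx).2 h)
          refine hupos.of_forall_exists ?_ ?_
          · rintro x (rfl | hx)
            · exact ⟨htS, .inl hta⟩
            · exact ⟨.inl hx.1, .inr hx.2⟩
          · rintro x ⟨hx, hxa | hxa⟩
            · exact ⟨u, .inr hu, .inl (hxa.trans hu.2)⟩
            · exact ⟨x, .inr (hupper x hx hxa), .inl le_rfl⟩
  have hlast : S (Nat.card G) = apSet p G \ apSetBad p N := by
    refine Set.Subset.antisymm ?_ fun E hE => .inr ⟨hE, Subgroup.card_le_card_group E⟩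
    rintro E (hE | hE)
    · exact ⟨hE.1, fun h => hE.2 h.2.2.1⟩
    · exact hE.1
  exact hlast ▸ hS _

end Skeleton

section Regular

variable {G : Type} [Group G] [Finite G] {p : ℕ} {ι : Type*} [MulAction G ι]
  {L : ι → Subgroup G}

/-- A subgroup of order `p` whose overgroups meeting the join do not form a connected poset
permutes the family regularly. -/
theorem IsCentreFreeFamily.regular_of_not_posetConn (hL : IsCentreFreeFamily L) (hp : p.Prime)
    (hact : ∀ (g : G) (i : ι), conjSub g (L i) = L (g • i)) (hdvd : ∀ i, p ∣ Nat.card ↥(L i))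
    (hι : 1 < Nat.card ι) {E : Subgroup G} (hE : E ∈ apSetBad p (⨆ i, L i)) :
    Nat.card ι = p ∧ (∀ i j : ι, ∃ g ∈ E, g • i = j) ∧ ∀ g ∈ E, g ≠ 1 → ∀ i : ι, g • i ≠ i := by
  obtain ⟨hEA, hEp, -, hEc⟩ := hE
  have horb : ∀ i : ι, MulAction.orbit ↥E i = Set.univ := by
    intro i
    rw [← Set.compl_empty_iff]
    by_contra h
    refine hEc (hL.posetConn_apSetOver_of_invariant hp hact hdvd hEA.2 (fun e he j hj => ?_)
      (MulAction.nonempty_orbit (M := ↥E) i) (Set.nonempty_iff_ne_empty.2 h))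
    exact MulAction.mem_orbit_of_mem_orbit (⟨e, he⟩ : E) hj
  have hcard : ∀ i : ι, Nat.card ι * Nat.card (MulAction.stabilizer ↥E i) = p := by
    intro i
    rw [← hEp, ← (MulAction.stabilizer ↥E i).index_mul_card, MulAction.index_stabilizer, horb,
      Set.ncard_univ]
  have hιp : Nat.card ι = p := by
    obtain ⟨i⟩ : Nonempty ι := (Nat.card_pos_iff.1 (by omega)).1
    exact ((Nat.dvd_prime hp).1 (Dvd.intro _ (hcard i))).resolve_left hι.ne'
  refine ⟨hιp, fun i j => ?_, fun g hg hg1 i hgi => ?_⟩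
  · obtain ⟨g, hg⟩ : j ∈ MulAction.orbit ↥E i := horb i ▸ Set.mem_univ j
    exact ⟨g, g.2, hg⟩
  · have h1 := hcard i
    rw [hιp, Nat.mul_eq_left hp.ne_zero] at h1
    have h2 : (⟨g, hg⟩ : E) ∈ MulAction.stabilizer ↥E i := hgi
    rw [Subgroup.eq_bot_of_card_eq _ h1, Subgroup.mem_bot] at h2
    exact hg1 (congrArg Subtype.val h2)

theorem IsCentreFreeFamily.exists_notMem_apSetBad [Finite ι] (hL : IsCentreFreeFamily L)
    (hp : p.Prime)
    (hact : ∀ (g : G) (i : ι), conjSub g (L i) = L (g • i)) (hdvd : ∀ i, p ∣ Nat.card ↥(L i))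
    (hι : 1 < Nat.card ι) {E : Subgroup G} (hE : E ∈ apSet p G) (hEp : Nat.card ↥E ≠ p) :
    ∃ F ∈ apSet p G, F ≤ E ∧ Nat.card ↥F = p ∧ F ∉ apSetBad p (⨆ i, L i) := by
  have := Fact.mk hp
  have hz : ∀ e ∈ E, e ≠ 1 → Subgroup.zpowers e ∈ apSet p G ∧ Subgroup.zpowers e ≤ E ∧
      Nat.card (Subgroup.zpowers e) = p := by
    intro e he he1
    have h1 := zpowers_mem_apSetIn (hE.2.pow_eq_one he) he1 he
    refine ⟨⟨h1.1, h1.2.1⟩, h1.2.2, ?_⟩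
    rw [Nat.card_zpowers]
    exact orderOf_eq_prime (hE.2.pow_eq_one he) he1
  obtain ⟨e, he, he1⟩ := (Subgroup.bot_or_exists_ne_one _).resolve_left hE.1
  by_cases hbad : Subgroup.zpowers e ∈ apSetBad p (⨆ i, L i)
  · obtain ⟨-, htrans, -⟩ := hL.regular_of_not_posetConn hp hact hdvd hι hbad
    obtain ⟨f, hf, hfe⟩ : ∃ f ∈ E, f ∉ Subgroup.zpowers e := by
      by_contra! h
      exact hEp (le_antisymm h (hz e he he1).2.1 ▸ (hz e he he1).2.2)
    have hnt : Nontrivial ι := Finite.one_lt_card_iff_nontrivial.1 hι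
    obtain ⟨i, j, hij⟩ := exists_pair_ne ι
    obtain ⟨g, hg, hgi⟩ := htrans i (f • i)
    have hgf : g⁻¹ * f ∈ E := E.mul_mem (E.inv_mem ((hz e he he1).2.1 hg)) hf
    have hgf1 : g⁻¹ * f ≠ 1 := fun h => hfe (inv_mul_eq_one.1 h ▸ hg)
    have hstab : Subgroup.zpowers (g⁻¹ * f) ≤ MulAction.stabilizer G i := by
      rw [Subgroup.zpowers_le, MulAction.mem_stabilizer_iff, mul_smul, ← hgi, inv_smul_smul]
    refine ⟨_, (hz _ hgf hgf1).1, (hz _ hgf hgf1).2.1, (hz _ hgf hgf1).2.2, fun h => h.2.2.2 ?_⟩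
    refine hL.posetConn_apSetOver_of_invariant hp hact hdvd (hz _ hgf hgf1).1.2 (J := {i}) ?_
      (Set.singleton_nonempty i) ⟨j, hij.symm⟩
    rintro x hx _ rfl
    exact hstab hx
  · exact ⟨_, (hz e he he1).1, (hz e he he1).2.1, (hz e he he1).2.2, hbad⟩

end Regular

/-- Under conditions (C1)–(C5), if `G` has a normal subgroup
`N = L₁ × ⋯ × L_r` (`r > 2`) with trivial centralizer which is the direct product of
nonabelian simple subnormal subgroups, then `π₁(A_p(G))` is free; moreover if `A_p(G)`
is not simply connected then `p` is odd, `r = p`, each `A_p(L i)` is disconnected, and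
some subgroup of order `p` permutes the `L i` regularly by conjugation. -/
theorem stmt13 (G : Type) [Group G] [Finite G] (p : ℕ) (hp : p.Prime)
    (hconn : ConnectedSpace ↥(geomRealOn (apSet p G)))
    (homega : omega1 p G = ⊤)
    (hOp : ∀ P : Subgroup G, P.Normal → IsPGroup p ↥P → P = ⊥)
    (hOp' : ∀ P : Subgroup G, P.Normal → ¬ p ∣ Nat.card ↥P → P = ⊥)
    (hindec : ¬ ∃ H K : Subgroup G, H.Normal ∧ K.Normal ∧ Nontrivial ↥H ∧
      Nontrivial ↥K ∧ H ⊓ K = ⊥ ∧ H ⊔ K = ⊤)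
    (r : ℕ) (hr : 2 < r) (N : Subgroup G) (L : Fin r → Subgroup G)
    (hNnormal : N.Normal) (hcent : Subgroup.centralizer (N : Set G) = ⊥)
    (hsub : ∀ i, IsSubnormal (L i)) (hsimple : ∀ i, IsSimpleGroup ↥(L i))
    (hna : ∀ i, ∃ a b : ↥(L i), a * b ≠ b * a)
    (hcomm : ∀ i j, i ≠ j → ∀ x ∈ L i, ∀ y ∈ L j, x * y = y * x)
    (hind : ∀ i, L i ⊓ (⨆ (j : Fin r) (_ : j ≠ i), L j) = ⊥)
    (hsup : (⨆ i, L i) = N) :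
    (∀ x : ↥(geomRealOn (apSet p G)), ∃ S : Type,
      Nonempty (FundamentalGroup ↥(geomRealOn (apSet p G)) x ≃* FreeGroup S)) ∧
    (¬ SimplyConnectedSpace ↥(geomRealOn (apSet p G)) →
      Odd p ∧ r = p ∧
      (∀ i, ¬ ConnectedSpace ↥(geomRealOn (apSetIn p (L i)))) ∧
      ∃ T : Subgroup G, Nat.card ↥T = p ∧
        (∀ g ∈ T, ∀ i, ∃ j, conjSub g (L i) = L j) ∧
        (∀ i j, ∃ g ∈ T, conjSub g (L i) = L j) ∧
        (∀ g ∈ T, g ≠ 1 → ∀ i, conjSub g (L i) ≠ L i)) := by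
  have := Fact.mk hp
  subst hsup
  have hL : IsCentreFreeFamily L :=
    ⟨fun i j hij x hx => Subgroup.mem_centralizer_iff.2 fun y hy => (hcomm i j hij x hx y hy).symm,
      hcent⟩
  have hne : ∀ i, L i ≠ ⊥ := fun i =>
    (Subgroup.nontrivial_iff_ne_bot _).1 (hsimple i).toNontrivial
  obtain ⟨_, hact⟩ := hL.exists_mulAction hne (hL.exists_conjSub_eq hNnormal)
  have hdvd := hL.dvd_card hp hact hne hOp'
  have hι : 1 < Nat.card (Fin r) := by
    rw [Nat.card_fin]
    omega
  have : Nonempty (Fin r) := ⟨⟨0, by omega⟩⟩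
  obtain ⟨hNconn, hNH1⟩ := hL.posetConn_and_posetH1Trivial hp hdvd
    (fun i => (⟨min i 2, by omega⟩ : Fin 3)) fun k => ⟨⟨k, by omega⟩, Fin.ext (by simp; omega)⟩
  have hover : ∀ E ∈ apSet p G, (apSetOver p (⨆ i, L i) E).Nonempty := fun E hE =>
    exists_mem_apSetOver hp hact hdvd hE.2
  have hsubset : apSetMeeting p (⨆ i, L i) ⊆ apSet p G \ apSetBad p (⨆ i, L i) := fun F hF =>
    ⟨hF.1, fun h => hF.2 h.2.2.1⟩
  have hZ1 : PosetH1Trivial (apSet p G \ apSetBad p (⨆ i, L i)) :=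
    posetH1Trivial_apSet_diff_apSetBad hp (posetH1Trivial_apSetMeeting hNH1) hover
      fun E hE _ hEp => hL.exists_notMem_apSetBad hp hact hdvd hι hE hEp
  have hZ : PosetConn (apSet p G \ apSetBad p (⨆ i, L i)) :=
    (posetConn_apSetMeeting hNconn).of_forall_exists hsubset fun E hE => by
      obtain ⟨F, hF⟩ := hover E hE.1
      exact ⟨F, hF.1, .inl hF.2⟩
  have hbad : ∀ E ∈ apSet p G \ (apSet p G \ apSetBad p (⨆ i, L i)),
      E ∈ apSetBad p (⨆ i, L i) := fun E hE => by
    by_contra h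
    exact hE.2 ⟨hE.1, h⟩
  refine ⟨fun x => exists_fundamentalGroup_equiv_freeGroup Set.sdiff_subset hZ hZ1 ?_ ?_ x,
    fun hsc => ?_⟩
  · intro E hE F hF hFE
    exact eq_of_le_of_card_eq_prime hp (hbad E hE).2.1 hF.1 hFE
  · intro E hE
    obtain ⟨F, hF⟩ := hover E hE.1
    exact ⟨F, hsubset hF.1, hF.2⟩
  · obtain ⟨E, hE⟩ : (apSetBad p (⨆ i, L i)).Nonempty := by
      by_contra! h
      rw [h, Set.sdiff_empty] at hZ hZ1
      exact hsc (simplyConnectedSpace_of_posetH1Trivial hZ hZ1)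
    obtain ⟨hrp, htrans, hfree⟩ := hL.regular_of_not_posetConn hp hact hdvd hι hE
    rw [Nat.card_fin] at hrp
    refine ⟨hp.odd_of_ne_two (by omega), hrp, fun i hi => ?_, E, hE.2.1,
      fun g _ i => ⟨_, hact g i⟩, fun i j => ?_, fun g hg hg1 i h => ?_⟩
    · obtain ⟨e, he, he1⟩ := (Subgroup.bot_or_exists_ne_one _).resolve_left hE.1.1
      have hep : orderOf e = p := orderOf_eq_prime (hE.1.2.pow_eq_one he) he1
      have hEe : Subgroup.zpowers e = E :=
        eq_of_le_of_card_eq_prime hp hE.2.1 (fun h => he1 (Subgroup.zpowers_eq_bot.1 h))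
          (Subgroup.zpowers_le.2 he)
      refine hE.2.2.2 (hEe ▸ hL.posetConn_apSetOver_of_regular hp hact hep (i := i)
        (fun k hk hkp => hfree _ (E.pow_mem he k) (pow_ne_one_of_lt_orderOf hk.ne' (hep ▸ hkp)) i)
        (fun j => hEe ▸ htrans i j) (PosetConn.of_connectedSpace hi))
    · obtain ⟨g, hg, rfl⟩ := htrans i j
      exact ⟨g, hg, hact g i⟩
    · exact hfree g hg hg1 i (hL.injective hne ((hact g i).symm.trans h))
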